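/- arXiv:1709.00869 — 3 statements merged into one kernel-verified Lean document; each statement's English description precedes it below -/
import Mathlib

section
/- Let G=(V,E) be a finite connected graph with m edges and minimum degree d, let P be the lazy random walk transition matrix and t_rel its relaxation time. For every vertex x and every integer t ≥ 1, the expected weighted number of intersections of two independent lazy random walks started at x satisfies t²/(2m) ≤ E_x[𝓘_t] ≤ t²/(2m) + 16·t_rel^{3/2}/d. -/
open Finset
open scoped Classical BigOperators

/-- The transition matrix of the lazy random walk on a finite graph `G`. -/
noncomputable def lazyP {V : Type} [Fintype V] (G : SimpleGraph V) : Matrix V V ℝ :=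
  fun u v =>
    if u = v then 1 / 2
    else if G.Adj u v then 1 / (2 * (G.degree u : ℝ)) else 0

/-- The number of edges of `G`. -/
noncomputable def numEdges {V : Type} [Fintype V] (G : SimpleGraph V) : ℕ :=
  G.edgeFinset.card

/-- The stationary distribution `π(u) = deg(u) / (2m)` of the lazy random walk. -/
noncomputable def statDist {V : Type} [Fintype V] (G : SimpleGraph V) (u : V) : ℝ :=
  (G.degree u : ℝ) / (2 * (numEdges G : ℝ))

/-- The second-largest eigenvalue `λ₂` of a reversible transition matrix: the supremum of
the (real) eigenvalues different from `1`. -/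
noncomputable def secondEig {V : Type} [Fintype V] (P : Matrix V V ℝ) : ℝ :=
  sSup {r : ℝ | r ≠ 1 ∧ ∃ f : V → ℝ, f ≠ 0 ∧ P.mulVec f = r • f}

/-- The relaxation time `t_rel = ⌈1 / (1 - λ₂)⌉`. -/
noncomputable def relTime {V : Type} [Fintype V] (P : Matrix V V ℝ) : ℕ :=
  ⌈1 / (1 - secondEig P)⌉₊

/-- The uniform mixing time of the lazy random walk on `G`. -/
noncomputable def unifTime {V : Type} [Fintype V] (G : SimpleGraph V) : ℕ :=
  sInf {t : ℕ | ∀ x y : V, |(lazyP G ^ t) x y / statDist G y - 1| ≤ 1 / 4}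

/-- The Green's function `g_t(x, u) = ∑_{i<t} P^i(x, u)`. -/
noncomputable def green {V : Type} [Fintype V] (P : Matrix V V ℝ) (t : ℕ) (x u : V) : ℝ :=
  ∑ i ∈ Finset.range t, (P ^ i) x u

/-- The value of a finite trajectory at a natural number index (junk beyond the horizon). -/
noncomputable def traj {V : Type} [Nonempty V] {t : ℕ} (p : Fin t → V) (i : ℕ) : V :=
  if h : i < t then p ⟨i, h⟩ else Classical.arbitrary V

/-- The probability that the chain `P` started at `x` follows the length-`t` trajectory `p`. -/
noncomputable def pathWeight {V : Type} [Fintype V] [Nonempty V] (P : Matrix V V ℝ)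
    (x : V) (t : ℕ) (p : Fin t → V) : ℝ :=
  (if traj p 0 = x then 1 else 0) *
    ∏ i ∈ Finset.range (t - 1), P (traj p i) (traj p (i + 1))

/-- Expectation of a functional of two independent length-`t` walks started at `x` and `y`. -/
noncomputable def E2 {V : Type} [Fintype V] [Nonempty V] (P : Matrix V V ℝ) (x y : V)
    (t : ℕ) (F : (Fin t → V) → (Fin t → V) → ℝ) : ℝ :=
  ∑ p : Fin t → V, ∑ q : Fin t → V, pathWeight P x t p * pathWeight P y t q * F p q

/-- Expectation of a functional of three independent length-`t` walks started at `x`. -/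
noncomputable def E3 {V : Type} [Fintype V] [Nonempty V] (P : Matrix V V ℝ) (x : V)
    (t : ℕ) (F : (Fin t → V) → (Fin t → V) → (Fin t → V) → ℝ) : ℝ :=
  ∑ p : Fin t → V, ∑ q : Fin t → V, ∑ r : Fin t → V,
    pathWeight P x t p * pathWeight P x t q * pathWeight P x t r * F p q r

/-- Expectation of a functional of `2K` independent length-`t` walks
(`K` pairs) started at `x`. -/
noncomputable def EK {V : Type} [Fintype V] [Nonempty V] (P : Matrix V V ℝ) (x : V)
    (t K : ℕ) (F : (Fin K → Fin t → V) → (Fin K → Fin t → V) → ℝ) : ℝ :=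
  ∑ X : Fin K → Fin t → V, ∑ Y : Fin K → Fin t → V,
    (∏ k, pathWeight P x t (X k)) * (∏ k, pathWeight P x t (Y k)) * F X Y

/-- Expectation of a functional of `K` independent length-`t` walks started at `x`. -/
noncomputable def EKone {V : Type} [Fintype V] [Nonempty V] (P : Matrix V V ℝ) (x : V)
    (t K : ℕ) (F : (Fin K → Fin t → V) → ℝ) : ℝ :=
  ∑ X : Fin K → Fin t → V, (∏ k, pathWeight P x t (X k)) * F X

/-- The weighted number of intersections of two trajectories over the time window `[a, b)`:
`∑_{i,j=a}^{b-1} (1 / deg(p_i)) 1{p_i = q_j}`. -/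
noncomputable def wInterIco {V : Type} [Fintype V] [Nonempty V] (G : SimpleGraph V)
    (a b : ℕ) {t : ℕ} (p q : Fin t → V) : ℝ :=
  ∑ i ∈ Finset.Ico a b, ∑ j ∈ Finset.Ico a b,
    if traj p i = traj q j then 1 / (G.degree (traj p i) : ℝ) else 0

/-- The weighted number of intersections `𝓘_t` of two trajectories, up to time `t - 1`. -/
noncomputable def wInter {V : Type} [Fintype V] [Nonempty V] (G : SimpleGraph V)
    {t : ℕ} (p q : Fin t → V) : ℝ :=
  wInterIco G 0 t p q

/-- The (unweighted) number of intersections `I_t` of two trajectories, up to time `t - 1`. -/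
noncomputable def nInter {V : Type} [Nonempty V] {t : ℕ} (p q : Fin t → V) : ℝ :=
  ∑ i ∈ Finset.range t, ∑ j ∈ Finset.range t,
    if traj p i = traj q j then (1 : ℝ) else 0

/-- `E_{x,y}[𝓘_t]`: expected weighted number of intersections of two independent lazy random
walks started at `x` and `y`. -/
noncomputable def EIxy {V : Type} [Fintype V] [Nonempty V] (G : SimpleGraph V)
    (x y : V) (t : ℕ) : ℝ :=
  E2 (lazyP G) x y t fun p q => wInter G p q

/-- `E_x[𝓘_t]`. -/
noncomputable def EI {V : Type} [Fintype V] [Nonempty V] (G : SimpleGraph V)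
    (x : V) (t : ℕ) : ℝ :=
  EIxy G x x t

/-- `E_x[𝓘_t²]`. -/
noncomputable def EIsq {V : Type} [Fintype V] [Nonempty V] (G : SimpleGraph V)
    (x : V) (t : ℕ) : ℝ :=
  E2 (lazyP G) x x t fun p q => (wInter G p q) ^ 2

/-- `E_x[𝓙_t]`: expected weighted number of intersections over the window
`[t_unif, t_unif + t - 1]`. -/
noncomputable def EJ {V : Type} [Fintype V] [Nonempty V] (G : SimpleGraph V)
    (x : V) (t : ℕ) : ℝ :=
  E2 (lazyP G) x x (unifTime G + t) fun p q =>
    wInterIco G (unifTime G) (unifTime G + t) p q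

/-- `E_x[𝓙_t²]`. -/
noncomputable def EJsq {V : Type} [Fintype V] [Nonempty V] (G : SimpleGraph V)
    (x : V) (t : ℕ) : ℝ :=
  E2 (lazyP G) x x (unifTime G + t) fun p q =>
    (wInterIco G (unifTime G) (unifTime G + t) p q) ^ 2

/-- `E_x[ℒ_t]`: expected weighted number of intersections between times `t` and `2t - 1`. -/
noncomputable def EL {V : Type} [Fintype V] [Nonempty V] (G : SimpleGraph V)
    (x : V) (t : ℕ) : ℝ :=
  E2 (lazyP G) x x (2 * t) fun p q => wInterIco G t (2 * t) p q

/-- `E_x[ℒ_t²]`. -/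
noncomputable def ELsq {V : Type} [Fintype V] [Nonempty V] (G : SimpleGraph V)
    (x : V) (t : ℕ) : ℝ :=
  E2 (lazyP G) x x (2 * t) fun p q => (wInterIco G t (2 * t) p q) ^ 2

/-- `E_x[ℒ_t^{(X,Y)} · ℒ_t^{(X,Z)}]` for three independent walks `X, Y, Z` started at `x`. -/
noncomputable def ELprod {V : Type} [Fintype V] [Nonempty V] (G : SimpleGraph V)
    (x : V) (t : ℕ) : ℝ :=
  E3 (lazyP G) x (2 * t) fun p q r =>
    wInterIco G t (2 * t) p q * wInterIco G t (2 * t) p r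

/-- The inner product `⟨f, g⟩_π = ∑_x π(x) f(x) g(x)`. -/
noncomputable def ipi {X : Type} [Fintype X] (π : X → ℝ) (f g : X → ℝ) : ℝ :=
  ∑ x, π x * f x * g x

/-- The position of the first occurrence of `s i` in the finite sequence `s`. -/
noncomputable def firstOcc {V : Type} {N : ℕ} (s : Fin N → V) (i : Fin N) : ℕ :=
  sInf {j : ℕ | ∃ h : j < N, s ⟨j, h⟩ = s i}

/-- The index (rank) of first occurrence of `s i` among the distinct values of `s`,
in order of first appearance. -/
noncomputable def rankSeq {V : Type} {N : ℕ} (s : Fin N → V) (i : Fin N) : ℕ :=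
  ((Finset.univ.image fun j : Fin N => firstOcc s j).filter
    fun a => a ≤ firstOcc s i).card

/-- The profile `Φ` of a finite sequence of vertices: the sequence of ranks of first
occurrence together with the sequence of degrees. -/
noncomputable def profileOf {V : Type} [Fintype V] (G : SimpleGraph V) {N : ℕ}
    (s : Fin N → V) : Fin N → ℕ × ℕ :=
  fun i => (rankSeq s i, G.degree (s i))

/-- Concatenation of `K` trajectories of length `t` into one sequence of length `K * t`. -/
noncomputable def concatW {V : Type} [Nonempty V] {K t : ℕ} (X : Fin K → Fin t → V)
    (i : Fin (K * t)) : V :=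
  if h : 0 < t then
    X ⟨i.1 / t, (Nat.div_lt_iff_lt_mul h).2 i.2⟩ ⟨i.1 % t, Nat.mod_lt _ h⟩
  else Classical.arbitrary V


section helpers
set_option linter.unusedSectionVars false
variable {V : Type} [Fintype V]

noncomputable def aA (G : SimpleGraph V) (u v : V) : ℝ := if G.Adj u v then 1 else 0
noncomputable def dD (G : SimpleGraph V) (u : V) : ℝ := (G.degree u : ℝ)
noncomputable def ipD (G : SimpleGraph V) (f g : V → ℝ) : ℝ := ∑ u, dD G u * f u * g u

lemma aA_symm (G : SimpleGraph V) (u v : V) : aA G u v = aA G v u := by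
  unfold aA; simp [G.adj_comm]

lemma aA_nonneg (G : SimpleGraph V) (u v : V) : 0 ≤ aA G u v := by
  unfold aA; split_ifs <;> norm_num

lemma dD_eq (G : SimpleGraph V) (u : V) : dD G u = ∑ v, aA G u v := by
  unfold dD aA
  rw [Finset.sum_boole, ← SimpleGraph.card_neighborFinset_eq_degree]
  congr 2
  ext v; simp

lemma dD_pos [Nontrivial V] (G : SimpleGraph V) (hG : G.Connected) (u : V) : 0 < dD G u := by
  unfold dD
  exact_mod_cast hG.preconnected.degree_pos_of_nontrivial u

lemma sum_dD (G : SimpleGraph V) : ∑ u, dD G u = 2 * (numEdges G : ℝ) := by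
  unfold dD numEdges
  exact_mod_cast G.sum_degrees_eq_twice_card_edges

lemma dP (G : SimpleGraph V) (hD : ∀ u, 0 < dD G u) (u v : V) :
    dD G u * lazyP G u v = ((if u = v then dD G u else 0) + aA G u v) / 2 := by
  have h := hD u
  unfold lazyP aA
  change dD G u * (if u = v then 1/2 else if G.Adj u v then 1 / (2 * dD G u) else 0) = _
  by_cases e : u = v
  · subst e; simp; ring
  · simp only [e, if_false]
    split_ifs
    · field_simp; ring
    · simp

lemma dP_symm (G : SimpleGraph V) (hD : ∀ u, 0 < dD G u) (u v : V) :
    dD G u * lazyP G u v = dD G v * lazyP G v u := by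
  rw [dP G hD, dP G hD, aA_symm]
  by_cases e : u = v
  · subst e; rfl
  · simp [e, Ne.symm e]

lemma Pmul (G : SimpleGraph V) (hD : ∀ u, 0 < dD G u) (f : V → ℝ) (u : V) :
    dD G u * ((lazyP G).mulVec f) u = (dD G u * f u + ∑ v, aA G u v * f v) / 2 := by
  rw [Matrix.mulVec, dotProduct, Finset.mul_sum]
  simp_rw [← mul_assoc, dP G hD, add_div, add_mul, Finset.sum_add_distrib, Finset.sum_div]
  congr 1
  · rw [Finset.sum_eq_single u]
    · simp; ring
    · intro b _ hb; simp [Ne.symm hb]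
    · simp
  · apply Finset.sum_congr rfl; intros; ring

lemma P_row (G : SimpleGraph V) (hD : ∀ u, 0 < dD G u) (u : V) : ∑ v, lazyP G u v = 1 := by
  have := Pmul G hD (fun _ => 1) u
  rw [Matrix.mulVec, dotProduct] at this
  simp only [mul_one, ← dD_eq] at this
  have h := hD u
  have h2 : dD G u * ∑ v, lazyP G u v = dD G u * 1 := by linarith
  exact mul_left_cancel₀ h.ne' h2

lemma P_nonneg (G : SimpleGraph V) (u v : V) : 0 ≤ lazyP G u v := by
  unfold lazyP; split_ifs <;> positivity

lemma Ppow_nonneg (G : SimpleGraph V) (k : ℕ) (u v : V) : 0 ≤ (lazyP G ^ k) u v := by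
  induction k generalizing u v with
  | zero => rw [pow_zero, Matrix.one_apply]; split_ifs <;> norm_num
  | succ k ih =>
    rw [pow_succ, Matrix.mul_apply]
    exact Finset.sum_nonneg fun w _ => mul_nonneg (ih _ _) (P_nonneg _ _ _)

lemma ip_self_adj (G : SimpleGraph V) (hD : ∀ u, 0 < dD G u) (f g : V → ℝ) :
    ipD G f ((lazyP G).mulVec g) = ipD G ((lazyP G).mulVec f) g := by
  unfold ipD
  simp_rw [Matrix.mulVec, dotProduct, Finset.mul_sum, Finset.sum_mul]
  rw [Finset.sum_comm]
  refine Finset.sum_congr rfl fun u _ => Finset.sum_congr rfl fun v _ => ?_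
  linear_combination f v * g u * dP_symm G hD v u

lemma ip_comm (G : SimpleGraph V) (f g : V → ℝ) : ipD G f g = ipD G g f := by
  unfold ipD; refine Finset.sum_congr rfl fun u _ => by ring

lemma ip_P (G : SimpleGraph V) (hD : ∀ u, 0 < dD G u) (f : V → ℝ) :
    ipD G f ((lazyP G).mulVec f) = (ipD G f f + ∑ u, ∑ v, aA G u v * f u * f v) / 2 := by
  unfold ipD
  rw [← Finset.sum_add_distrib, Finset.sum_div]
  refine Finset.sum_congr rfl fun u _ => ?_
  have : ∑ v, aA G u v * f u * f v = f u * ∑ v, aA G u v * f v := by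
    rw [Finset.mul_sum]; refine Finset.sum_congr rfl fun u _ => by ring
  rw [this]
  linear_combination f u * Pmul G hD f u

lemma ip_sum1 (G : SimpleGraph V) (f : V → ℝ) :
    ∑ u, ∑ v, aA G u v * f u ^ 2 = ipD G f f := by
  unfold ipD
  refine Finset.sum_congr rfl fun u _ => ?_
  rw [← Finset.sum_mul, ← dD_eq]; ring

lemma ip_sum2 (G : SimpleGraph V) (f : V → ℝ) :
    ∑ u, ∑ v, aA G u v * f v ^ 2 = ipD G f f := by
  rw [← ip_sum1, Finset.sum_comm]
  refine Finset.sum_congr rfl fun u _ => Finset.sum_congr rfl fun v _ => ?_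
  rw [aA_symm]

lemma dirichlet (G : SimpleGraph V) (hD : ∀ u, 0 < dD G u) (f : V → ℝ) :
    ∑ u, ∑ v, aA G u v * (f u - f v) ^ 2 =
      4 * (ipD G f f - ipD G f ((lazyP G).mulVec f)) := by
  have : ∀ u v, aA G u v * (f u - f v) ^ 2 =
    aA G u v * f u ^ 2 + aA G u v * f v ^ 2 - 2 * (aA G u v * f u * f v) := fun u v => by ring
  simp_rw [this, Finset.sum_sub_distrib, Finset.sum_add_distrib, ← Finset.mul_sum]
  rw [ip_sum1, ip_sum2, ip_P G hD]; ring

lemma psd (G : SimpleGraph V) (hD : ∀ u, 0 < dD G u) (f : V → ℝ) :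
    0 ≤ ipD G f ((lazyP G).mulVec f) := by
  have h0 : 0 ≤ ∑ u, ∑ v, aA G u v * (f u + f v) ^ 2 :=
    Finset.sum_nonneg fun u _ => Finset.sum_nonneg fun v _ =>
      mul_nonneg (aA_nonneg _ _ _) (sq_nonneg _)
  have : ∀ u v, aA G u v * (f u + f v) ^ 2 =
    aA G u v * f u ^ 2 + aA G u v * f v ^ 2 + 2 * (aA G u v * f u * f v) := fun u v => by ring
  simp_rw [this, Finset.sum_add_distrib, ← Finset.mul_sum] at h0
  rw [ip_sum1, ip_sum2] at h0
  rw [ip_P G hD]; linarith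

lemma ip_nonneg (G : SimpleGraph V) (hD : ∀ u, 0 < dD G u) (f : V → ℝ) :
    0 ≤ ipD G f f := by
  unfold ipD
  refine Finset.sum_nonneg fun u _ => ?_
  rw [mul_assoc]; exact mul_nonneg (hD u).le (mul_self_nonneg _)

/-! path expansions -/

lemma traj_cons_zero [Nonempty V] {t : ℕ} (a : V) (p : Fin t → V) :
    traj (Fin.cons a p : Fin (t+1) → V) 0 = a := by
  simp [traj]

lemma traj_cons_succ [Nonempty V] {t : ℕ} (a : V) (p : Fin t → V) (i : ℕ) :
    traj (Fin.cons a p : Fin (t+1) → V) (i+1) = traj p i := by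
  unfold traj
  by_cases h : i < t
  · have : (⟨i+1, by omega⟩ : Fin (t+1)) = Fin.succ ⟨i, h⟩ := rfl
    simp only [h, Nat.add_lt_add_iff_right, dite_true]
    rw [this, Fin.cons_succ]
  · simp [h]

lemma fin_sum_split {t : ℕ} (F : (Fin (t+1) → V) → ℝ) :
    ∑ p, F p = ∑ a, ∑ p : Fin t → V, F (Fin.cons a p) := by
  rw [← (Fin.consEquiv (fun _ : Fin (t+1) => V)).sum_comp, Fintype.sum_prod_type]
  rfl

lemma pw_cons [Nonempty V] (P : Matrix V V ℝ) (x a : V) (t : ℕ) (p : Fin (t+1) → V) :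
    pathWeight P x (t+2) (Fin.cons a p : Fin (t+2) → V) =
      (if a = x then 1 else 0) * ∑ y, P x y * pathWeight P y (t+1) p := by
  unfold pathWeight
  simp only [Nat.add_sub_cancel, Nat.reduceSubDiff]
  rw [traj_cons_zero, Finset.prod_range_succ', traj_cons_zero]
  simp only [traj_cons_succ]
  by_cases e : a = x
  · subst e
    rw [Finset.sum_eq_single (traj p 0)]
    · simp; ring
    · intro b _ hb; simp [Ne.symm hb]
    · simp
  · simp [e]

lemma pw_sum_cons [Nonempty V] (P : Matrix V V ℝ) (x : V) (t : ℕ) (F : (Fin (t+2) → V) → ℝ) :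
    ∑ p, pathWeight P x (t+2) p * F p =
      ∑ y, P x y * ∑ p : Fin (t+1) → V, pathWeight P y (t+1) p * F (Fin.cons x p) := by
  rw [fin_sum_split]
  simp only [pw_cons]
  rw [Finset.sum_eq_single x]
  · simp only [if_true, one_mul, Finset.sum_mul, Finset.mul_sum]
    rw [Finset.sum_comm]
    refine Finset.sum_congr rfl fun u _ => Finset.sum_congr rfl fun v _ => ?_
    ring
  · intro b _ hb; simp [hb]
  · simp

lemma pw_mass [Nonempty V] (P : Matrix V V ℝ) (hP : ∀ u, ∑ v, P u v = 1) (x : V) (t : ℕ) :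
    ∑ p, pathWeight P x (t+1) p = 1 := by
  induction t generalizing x with
  | zero =>
    rw [fin_sum_split]
    simp [pathWeight, traj_cons_zero]
  | succ t ih =>
    have := pw_sum_cons P x t (fun _ => 1)
    simp only [mul_one, ih, hP] at this
    exact this

lemma pw_marg [Nonempty V] (P : Matrix V V ℝ) (hP : ∀ u, ∑ v, P u v = 1) (x u : V) (t i : ℕ)
    (hi : i < t) :
    ∑ p, pathWeight P x t p * (if traj p i = u then 1 else 0) = (P ^ i) x u := by
  induction i generalizing x t with
  | zero =>
    obtain ⟨t, rfl⟩ : ∃ s, t = s + 1 := ⟨t - 1, by omega⟩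
    have : ∀ p, pathWeight P x (t+1) p * (if traj p 0 = u then 1 else 0) =
        pathWeight P x (t+1) p * (if x = u then 1 else 0) := by
      intro p
      unfold pathWeight
      by_cases e : traj p 0 = x
      · rw [e]
      · simp [e]
    simp_rw [this, ← Finset.sum_mul, pw_mass P hP, one_mul]
    rw [pow_zero, Matrix.one_apply]
  | succ i ih =>
    obtain ⟨t, rfl⟩ : ∃ s, t = s + 2 := ⟨t - 2, by omega⟩
    rw [pw_sum_cons]
    simp only [traj_cons_succ]
    rw [pow_succ', Matrix.mul_apply]
    refine Finset.sum_congr rfl fun y _ => ?_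
    rw [ih y (t+1) (by omega)]

lemma EI_eq [Nonempty V] (G : SimpleGraph V) (hD : ∀ u, 0 < dD G u) (x : V) (t : ℕ) :
    EI G x t = ∑ u, green (lazyP G) t x u ^ 2 / dD G u := by
  have hg : ∀ u, green (lazyP G) t x u =
      ∑ p : Fin t → V, pathWeight (lazyP G) x t p *
        ∑ i ∈ Finset.range t, (if traj p i = u then 1 else 0) := by
    intro u
    simp_rw [Finset.mul_sum]
    rw [Finset.sum_comm]
    unfold green
    refine Finset.sum_congr rfl fun i hi => ?_
    rw [pw_marg _ (P_row G hD) x u t i (Finset.mem_range.1 hi)]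
  have hw : ∀ p q : Fin t → V, wInter G p q =
      ∑ u, (∑ i ∈ Finset.range t, (if traj p i = u then 1 else 0)) *
        (∑ j ∈ Finset.range t, (if traj q j = u then 1 else 0)) / dD G u := by
    intro p q
    unfold wInter wInterIco
    simp_rw [Finset.sum_mul_sum, Finset.sum_div, ← Finset.range_eq_Ico]
    rw [Finset.sum_comm (s := Finset.univ)]
    refine Finset.sum_congr rfl fun i hi => ?_
    rw [Finset.sum_comm (s := Finset.univ)]
    refine Finset.sum_congr rfl fun j hj => ?_
    rw [Finset.sum_eq_single (traj p i)]
    · simp only [if_true, dD, eq_comm (a := traj q j)]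
      split_ifs <;> simp
    · intro b _ hb; simp [Ne.symm hb]
    · simp
  obtain ⟨N, hN⟩ : ∃ N : (Fin t → V) → V → ℝ,
    ∀ p u, (∑ i ∈ Finset.range t, (if traj p i = u then (1:ℝ) else 0)) = N p u := ⟨_, fun _ _ => rfl⟩
  simp only [hN] at hg hw
  unfold EI EIxy E2
  simp only [hw, hg, sq, Finset.sum_mul, Finset.mul_sum, Finset.sum_div]
  conv_rhs =>
    rw [Finset.sum_comm]
    enter [2, p]
    rw [Finset.sum_comm]
  refine Finset.sum_congr rfl fun p _ => Finset.sum_congr rfl fun q _ => ?_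
  refine Finset.sum_congr rfl fun u _ => ?_
  ring

lemma spec (G : SimpleGraph V) (hD : ∀ u, 0 < dD G u) :
    ∃ (μ : V → ℝ) (f : V → V → ℝ), (∀ i, (lazyP G).mulVec (f i) = μ i • f i ∧ f i ≠ 0) ∧
      ∀ g h, ipD G g h = ∑ i, ipD G g (f i) * ipD G h (f i) := by
  let s : V → ℝ := fun u => √(dD G u)
  have hs : ∀ u, 0 < s u := fun u => Real.sqrt_pos.2 (hD u)
  have hss : ∀ u, s u * s u = dD G u := fun u => Real.mul_self_sqrt (hD u).le
  let S : Matrix V V ℝ := fun u v => dD G u * lazyP G u v / (s u * s v)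
  have hS : S.IsHermitian := by
    ext u v
    rw [Matrix.conjTranspose_apply, star_trivial]
    change dD G v * lazyP G v u / (s v * s u) = dD G u * lazyP G u v / (s u * s v)
    rw [dP_symm G hD u v, mul_comm (s u)]
  let b := hS.eigenvectorBasis
  have hip : ∀ (g : V → ℝ) i, ipD G g (fun u => b i u / s u) =
      inner ℝ (WithLp.toLp 2 (fun u => s u * g u) : EuclideanSpace ℝ V) (b i) := by
    intro g i
    simp only [ipD, PiLp.inner_apply, RCLike.inner_apply, conj_trivial]
    refine Finset.sum_congr rfl fun u _ => ?_
    have := (hs u).ne'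
    rw [← hss u]; field_simp
  refine ⟨hS.eigenvalues, fun i u => b i u / s u, fun i => ⟨?_, ?_⟩, ?_⟩
  · have h := hS.mulVec_eigenvectorBasis i
    ext u
    have h2 := congrFun h u
    simp only [Matrix.mulVec, dotProduct, Pi.smul_apply, smul_eq_mul] at h2 ⊢
    change ∑ v, S u v * b i v = hS.eigenvalues i * b i u at h2
    rw [← mul_div_assoc, ← h2, Finset.sum_div]
    refine Finset.sum_congr rfl fun v _ => ?_
    simp only [S]
    have := (hs u).ne'
    have := (hs v).ne'
    rw [← hss u]; field_simp
  · intro h0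
    have h1 : b i = 0 := by
      ext u
      have := congrFun h0 u
      simpa [(hs u).ne'] using this
    have := b.orthonormal.1 i
    rw [h1] at this; simp at this
  · intro g h
    simp only [hip]
    have := b.sum_inner_mul_inner (WithLp.toLp 2 (fun u => s u * g u) : EuclideanSpace ℝ V)
      (WithLp.toLp 2 (fun u => s u * h u) : EuclideanSpace ℝ V)
    simp_rw [real_inner_comm _ (WithLp.toLp 2 (fun u => s u * h u) : EuclideanSpace ℝ V)]
    rw [this]
    simp only [ipD, PiLp.inner_apply, RCLike.inner_apply, conj_trivial]
    refine Finset.sum_congr rfl fun u _ => ?_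
    rw [← hss u]; ring

lemma energy_nonneg (G : SimpleGraph V) (f : V → ℝ) :
    0 ≤ ∑ u, ∑ v, aA G u v * (f u - f v) ^ 2 :=
  Finset.sum_nonneg fun u _ => Finset.sum_nonneg fun v _ =>
      mul_nonneg (aA_nonneg _ _ _) (sq_nonneg _)

lemma ip_smul (G : SimpleGraph V) (f g : V → ℝ) (r : ℝ) : ipD G f (r • g) = r * ipD G f g := by
  unfold ipD; rw [Finset.mul_sum]
  refine Finset.sum_congr rfl fun u _ => ?_
  simp only [Pi.smul_apply, smul_eq_mul]; ring

lemma ip_pos (G : SimpleGraph V) (hD : ∀ u, 0 < dD G u) (f : V → ℝ) (hf : f ≠ 0) :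
    0 < ipD G f f := by
  obtain ⟨u, hu⟩ := Function.ne_iff.1 hf
  unfold ipD
  refine Finset.sum_pos' (fun v _ => ?_) ⟨u, Finset.mem_univ _, ?_⟩
  · rw [mul_assoc]; exact mul_nonneg (hD v).le (mul_self_nonneg _)
  · rw [mul_assoc]; exact mul_pos (hD u) (mul_self_pos.2 hu)

lemma eig_le_one (G : SimpleGraph V) (hD : ∀ u, 0 < dD G u) (f : V → ℝ) (hf : f ≠ 0) (r : ℝ)
    (h : (lazyP G).mulVec f = r • f) : r ≤ 1 := by
  have h1 := dirichlet G hD f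
  have h2 := energy_nonneg G f
  rw [h, ip_smul] at h1
  have h3 := ip_pos G hD f hf
  by_contra hr
  push Not at hr
  nlinarith

lemma eig_one_const (G : SimpleGraph V) (hG : G.Connected) (hD : ∀ u, 0 < dD G u) (f : V → ℝ)
    (h : (lazyP G).mulVec f = f) (u v : V) : f u = f v := by
  have h1 := dirichlet G hD f
  rw [h, sub_self, mul_zero] at h1
  have hadj : ∀ u v, G.Adj u v → f u = f v := by
    intro u v huv
    rw [Finset.sum_eq_zero_iff_of_nonneg (fun u _ => Finset.sum_nonneg fun v _ =>
      mul_nonneg (aA_nonneg _ _ _) (sq_nonneg _))] at h1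
    have h2 := h1 u (Finset.mem_univ _)
    rw [Finset.sum_eq_zero_iff_of_nonneg (fun v _ =>
      mul_nonneg (aA_nonneg _ _ _) (sq_nonneg _))] at h2
    have h3 := h2 v (Finset.mem_univ _)
    simp only [aA, huv, if_true, one_mul] at h3
    have := pow_eq_zero_iff (two_ne_zero) |>.1 h3
    linarith
  obtain ⟨w⟩ := hG.preconnected u v
  induction w with
  | nil => rfl
  | cons hh _ ih => rw [hadj _ _ hh, ih]

lemma eig_set_finite (G : SimpleGraph V) :
    {r : ℝ | r ≠ 1 ∧ ∃ f : V → ℝ, f ≠ 0 ∧ (lazyP G).mulVec f = r • f}.Finite := by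
  refine (Module.End.finite_hasEigenvalue (Matrix.toLin' (lazyP G))).subset ?_
  rintro r ⟨_, f, hf, h⟩
  refine Module.End.hasEigenvalue_of_hasEigenvector (x := f) ?_
  rw [Module.End.hasEigenvector_iff]
  exact ⟨by rw [Module.End.mem_eigenspace_iff, Matrix.toLin'_apply, h], hf⟩

lemma secondEig_lt_one (G : SimpleGraph V) (hD : ∀ u, 0 < dD G u) : secondEig (lazyP G) < 1 := by
  unfold secondEig
  rcases Set.eq_empty_or_nonempty
    {r : ℝ | r ≠ 1 ∧ ∃ f : V → ℝ, f ≠ 0 ∧ (lazyP G).mulVec f = r • f} with h | h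
  · rw [h]; simp
  · have := h.csSup_mem (eig_set_finite G)
    obtain ⟨h1, f, hf, h2⟩ := this
    exact lt_of_le_of_ne (eig_le_one G hD f hf _ h2) h1

lemma poincare (G : SimpleGraph V) (hG : G.Connected) (hD : ∀ u, 0 < dD G u) (h : V → ℝ)
    (h0 : ∑ u, dD G u * h u = 0) :
    (1 - secondEig (lazyP G)) * ipD G h h ≤ ipD G h h - ipD G h ((lazyP G).mulVec h) := by
  obtain ⟨μ, f, hf, hsum⟩ := spec G hD
  have h1 : ipD G h ((lazyP G).mulVec h) = ∑ i, μ i * (ipD G h (f i)) ^ 2 := by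
    rw [hsum]
    refine Finset.sum_congr rfl fun i _ => ?_
    rw [← ip_self_adj G hD, (hf i).1, ip_smul]; ring
  have h2 : ∑ i, μ i * (ipD G h (f i)) ^ 2 ≤ secondEig (lazyP G) * ipD G h h := by
    rw [hsum h h, Finset.mul_sum]
    refine Finset.sum_le_sum fun i _ => ?_
    by_cases hi : μ i = 1
    · have hc := eig_one_const G hG hD (f i) (by rw [(hf i).1, hi, one_smul])
      have : ipD G h (f i) = 0 := by
        unfold ipD
        simp_rw [fun u => hc u i, ← Finset.sum_mul, h0, zero_mul]
      simp [this]
    · rw [← sq]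
      refine mul_le_mul_of_nonneg_right ?_ (sq_nonneg _)
      exact le_csSup (eig_set_finite G).bddAbove ⟨hi, f i, (hf i).2, (hf i).1⟩
  linarith

lemma poincare' (G : SimpleGraph V) (hG : G.Connected) (hD : ∀ u, 0 < dD G u) (h : V → ℝ)
    (h0 : ∑ u, dD G u * h u = 0) :
    ipD G h h ≤ relTime (lazyP G) * (ipD G h h - ipD G h ((lazyP G).mulVec h)) := by
  have h1 := poincare G hG hD h h0
  have h2 := secondEig_lt_one G hD
  have h3 : 1 / (1 - secondEig (lazyP G)) ≤ relTime (lazyP G) := Nat.le_ceil _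
  have h4 : 0 ≤ ipD G h h - ipD G h ((lazyP G).mulVec h) := by
    have := dirichlet G hD h
    have := energy_nonneg G h
    linarith
  refine le_trans ?_ (mul_le_mul_of_nonneg_right h3 h4)
  rw [one_div, ← div_eq_inv_mul, le_div_iff₀ (by linarith)]
  linarith

lemma relTime_pos (G : SimpleGraph V) (hD : ∀ u, 0 < dD G u) : 1 ≤ relTime (lazyP G) := by
  have h2 := secondEig_lt_one G hD
  exact Nat.ceil_pos.2 (one_div_pos.2 (by linarith))

noncomputable def qQ (G : SimpleGraph V) (x : V) (k : ℕ) : V → ℝ :=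
  (lazyP G ^ k).mulVec (fun u => (if u = x then 1 else 0) / dD G u - 1 / (2 * (numEdges G : ℝ)))

lemma qQ_succ (G : SimpleGraph V) (x : V) (k : ℕ) :
    qQ G x (k+1) = (lazyP G).mulVec (qQ G x k) := by
  unfold qQ; rw [Matrix.mulVec_mulVec, ← pow_succ']

lemma qQ_pow (G : SimpleGraph V) (hD : ∀ u, 0 < dD G u) (x : V) (k : ℕ) (u : V) :
    (lazyP G ^ k) x u = dD G u * (qQ G x k u + 1 / (2 * (numEdges G : ℝ))) := by
  induction k generalizing u with
  | zero =>
    have := (hD u).ne'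
    simp only [qQ, pow_zero, Matrix.one_mulVec, Matrix.one_apply, sub_add_cancel]
    rw [mul_div_cancel₀ _ this]
    simp [eq_comm]
  | succ k ih =>
    rw [pow_succ, Matrix.mul_apply, qQ_succ]
    have : ∀ v, (lazyP G ^ k) x v * lazyP G v u = dD G u * (lazyP G u v * qQ G x k v) +
        dD G u * (1 / (2 * (numEdges G : ℝ))) * lazyP G u v := by
      intro v
      rw [ih]
      linear_combination (qQ G x k v + 1 / (2 * (numEdges G : ℝ))) * dP_symm G hD v u
    simp_rw [this, Finset.sum_add_distrib, ← Finset.mul_sum, P_row G hD]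
    rw [Matrix.mulVec, dotProduct]; ring

lemma ip_shift (G : SimpleGraph V) (hD : ∀ u, 0 < dD G u) (x : V) (j k : ℕ) :
    ipD G (qQ G x j) (qQ G x (k+1)) = ipD G (qQ G x (j+1)) (qQ G x k) := by
  rw [qQ_succ, qQ_succ, ip_self_adj G hD]

lemma ip_q_nonneg (G : SimpleGraph V) (hD : ∀ u, 0 < dD G u) (x : V) (j k : ℕ) :
    0 ≤ ipD G (qQ G x j) (qQ G x k) := by
  have key : ∀ n j, 0 ≤ ipD G (qQ G x j) (qQ G x (j+n)) := by
    intro n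
    induction n using Nat.twoStepInduction with
    | zero => intro j; exact ip_nonneg G hD _
    | one => intro j; rw [qQ_succ]; exact psd G hD _
    | more n ih _ =>
      intro j
      have := ih (j+1)
      rw [show j + (n+2) = (j + n + 1) + 1 by ring, ip_shift G hD]
      rwa [show j + 1 + n = j + n + 1 by ring] at this
  rcases le_total j k with h | h
  · obtain ⟨n, rfl⟩ := Nat.exists_eq_add_of_le h; exact key n j
  · obtain ⟨n, rfl⟩ := Nat.exists_eq_add_of_le h; rw [ip_comm]; exact key n k

noncomputable def hH (G : SimpleGraph V) (x : V) (t : ℕ) : V → ℝ :=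
  fun u => ∑ i ∈ Finset.range t, qQ G x i u

lemma sum_dq (G : SimpleGraph V) (hD : ∀ u, 0 < dD G u) (hm : (numEdges G : ℝ) ≠ 0) (x : V)
    (k : ℕ) : ∑ u, dD G u * qQ G x k u = 0 := by
  induction k with
  | zero =>
    simp only [qQ, pow_zero, Matrix.one_mulVec]
    have : ∀ u, dD G u * ((if u = x then 1 else 0) / dD G u - 1 / (2 * (numEdges G : ℝ))) =
      (if u = x then 1 else 0) - dD G u * (1 / (2 * (numEdges G : ℝ))) := by
      intro u
      have := (hD u).ne'
      rw [mul_sub, mul_div_cancel₀ _ this]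
    simp_rw [this, Finset.sum_sub_distrib, ← Finset.sum_mul, sum_dD]
    simp; field_simp; simp
  | succ k ih =>
    have := ip_self_adj G hD (fun _ => 1) (qQ G x k)
    rw [← qQ_succ] at this
    have h1 : (lazyP G).mulVec (fun _ => 1) = fun _ => 1 := by
      ext u; simp [Matrix.mulVec, dotProduct, P_row G hD]
    rw [h1] at this
    simp only [ipD, mul_one] at this
    rw [this, ih]

lemma sum_dh (G : SimpleGraph V) (hD : ∀ u, 0 < dD G u) (hm : (numEdges G : ℝ) ≠ 0) (x : V)
    (t : ℕ) : ∑ u, dD G u * hH G x t u = 0 := by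
  unfold hH
  simp_rw [Finset.mul_sum]
  rw [Finset.sum_comm]
  exact Finset.sum_eq_zero fun i _ => sum_dq G hD hm x i

lemma EI_h [Nonempty V] (G : SimpleGraph V) (hD : ∀ u, 0 < dD G u) (hm : (numEdges G : ℝ) ≠ 0)
    (x : V) (t : ℕ) :
    EI G x t = (t:ℝ)^2 / (2 * (numEdges G : ℝ)) + ipD G (hH G x t) (hH G x t) := by
  rw [EI_eq G hD]
  have hg : ∀ u, green (lazyP G) t x u ^ 2 / dD G u =
      dD G u * ((t:ℝ) / (2 * (numEdges G : ℝ)))^2 +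
      2 * ((t:ℝ) / (2 * (numEdges G : ℝ))) * (dD G u * hH G x t u) +
      dD G u * hH G x t u * hH G x t u := by
    intro u
    have : green (lazyP G) t x u = dD G u * (hH G x t u + (t:ℝ) / (2 * (numEdges G : ℝ))) := by
      unfold green hH
      simp_rw [qQ_pow G hD, ← Finset.mul_sum, Finset.sum_add_distrib]
      simp; left; ring
    rw [this]
    have := (hD u).ne'
    field_simp
    ring
  simp_rw [hg, Finset.sum_add_distrib, ← Finset.mul_sum, ← Finset.sum_mul, sum_dh G hD hm, sum_dD]
  unfold ipD
  field_simp; ring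

lemma P_h (G : SimpleGraph V) (x : V) (t : ℕ) (u : V) :
    hH G x t u - (lazyP G).mulVec (hH G x t) u = qQ G x 0 u - qQ G x t u := by
  have : (lazyP G).mulVec (hH G x t) u = ∑ i ∈ Finset.range t, qQ G x (i+1) u := by
    simp_rw [qQ_succ]
    unfold hH
    simp only [Matrix.mulVec, dotProduct, Finset.mul_sum]
    rw [Finset.sum_comm]
  rw [this]
  unfold hH
  rw [← Finset.sum_sub_distrib, Finset.sum_range_sub' (fun i => qQ G x i u)]

lemma energy_h (G : SimpleGraph V) (hD : ∀ u, 0 < dD G u) (hm : (numEdges G : ℝ) ≠ 0) (x : V)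
    (t : ℕ) : ipD G (hH G x t) (hH G x t) - ipD G (hH G x t) ((lazyP G).mulVec (hH G x t))
      ≤ hH G x t x := by
  have h1 : ipD G (hH G x t) (hH G x t) - ipD G (hH G x t) ((lazyP G).mulVec (hH G x t)) =
      ipD G (hH G x t) (qQ G x 0) - ipD G (hH G x t) (qQ G x t) := by
    unfold ipD
    rw [← Finset.sum_sub_distrib, ← Finset.sum_sub_distrib]
    refine Finset.sum_congr rfl fun u _ => ?_
    rw [← mul_sub, ← mul_sub, P_h]
  have h2 : 0 ≤ ipD G (hH G x t) (qQ G x t) := by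
    have : ipD G (hH G x t) (qQ G x t) = ∑ i ∈ Finset.range t, ipD G (qQ G x i) (qQ G x t) := by
      unfold ipD hH
      rw [Finset.sum_comm]
      simp_rw [Finset.mul_sum, Finset.sum_mul]
    rw [this]
    exact Finset.sum_nonneg fun i _ => ip_q_nonneg G hD x i t
  have h3 : ipD G (hH G x t) (qQ G x 0) = hH G x t x := by
    have : ∀ u, dD G u * hH G x t u * qQ G x 0 u = (if u = x then hH G x t u else 0) -
        dD G u * hH G x t u * (1 / (2 * (numEdges G : ℝ))) := by
      intro u
      have := (hD u).ne'
      simp only [qQ, pow_zero, Matrix.one_mulVec]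
      rw [mul_sub]; congr 1
      split_ifs
      · field_simp
      · simp
    unfold ipD
    simp_rw [this, Finset.sum_sub_distrib, ← Finset.sum_mul, sum_dh G hD hm]
    simp
  rw [h1, h3]; linarith

lemma nbr_sum (G : SimpleGraph V) (hD : ∀ u, 0 < dD G u) (x : V) (t : ℕ) (u : V) :
    dD G u * hH G x t u - (if u = x then 2 else 0) ≤ ∑ v, aA G u v * hH G x t v := by
  have h1 := Pmul G hD (hH G x t) u
  have h2 := P_h G x t u
  have h3 : dD G u * (qQ G x 0 u - qQ G x t u) = (if u = x then 1 else 0) - (lazyP G ^ t) x u := by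
    have := qQ_pow G hD x 0 u
    rw [qQ_pow G hD x t]
    rw [pow_zero, Matrix.one_apply] at this
    simp only [eq_comm (a := u)]
    rw [this]; ring
  have h4 := Ppow_nonneg G t x u
  rw [← h2] at h3
  split_ifs at h3 ⊢ <;> linarith

lemma geodesic (G : SimpleGraph V) (hG : G.Connected) (x y : V) :
    ∃ z : ℕ → V, z 0 = x ∧ z (G.dist x y) = y ∧ (∀ i ≤ G.dist x y, G.dist x (z i) = i) ∧
      ∀ i < G.dist x y, G.Adj (z i) (z (i+1)) := by
  obtain ⟨p, hp⟩ := hG.exists_walk_length_eq_dist x y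
  refine ⟨p.getVert, by simp, by rw [← hp]; simp, fun i hi => ?_, fun i hi => ?_⟩
  · have h1 := SimpleGraph.dist_le (p.take i)
    have h2 := SimpleGraph.dist_le (p.drop i)
    have h3 := hG.dist_triangle (u := x) (v := p.getVert i) (w := y)
    rw [SimpleGraph.Walk.take_length] at h1
    rw [SimpleGraph.Walk.drop_length] at h2
    omega
  · exact p.adj_getVert_succ (by omega)

lemma path_bound (G : SimpleGraph V) (f : V → ℝ) (z : ℕ → V) (L : ℕ)
    (hinj : ∀ i ≤ L, ∀ j ≤ L, z i = z j → i = j) (hadj : ∀ i < L, G.Adj (z i) (z (i+1)))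
    (i : ℕ) (hi : i ≤ L) :
    (f (z 0) - f (z i)) ^ 2 ≤ i * ∑ u, ∑ v, aA G u v * (f u - f v) ^ 2 := by
  have h1 : f (z 0) - f (z i) = ∑ k ∈ Finset.range i, (f (z k) - f (z (k+1))) :=
    (Finset.sum_range_sub' (fun k => f (z k)) i).symm
  have h2 := sq_sum_le_card_mul_sum_sq (s := Finset.range i) (f := fun k => (f (z k) - f (z (k+1))))
  rw [h1]
  refine h2.trans ?_
  rw [Finset.card_range]
  refine mul_le_mul_of_nonneg_left ?_ (Nat.cast_nonneg _)
  calc ∑ k ∈ Finset.range i, (f (z k) - f (z (k+1))) ^ 2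
      ≤ ∑ k ∈ Finset.range i, ∑ v, aA G (z k) v * (f (z k) - f v) ^ 2 := by
        refine Finset.sum_le_sum fun k hk => ?_
        have hk' := Finset.mem_range.1 hk
        have := Finset.single_le_sum (f := fun v => aA G (z k) v * (f (z k) - f v) ^ 2)
          (fun v _ => mul_nonneg (aA_nonneg G _ _) (sq_nonneg _)) (Finset.mem_univ (z (k+1)))
        simpa [aA, hadj k (by omega)] using this
    _ = ∑ u ∈ (Finset.range i).image z, ∑ v, aA G u v * (f u - f v) ^ 2 := by
        rw [Finset.sum_image]
        intro a ha b hb hab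
        have ha' := Finset.mem_range.1 ha
        have hb' := Finset.mem_range.1 hb
        exact hinj a (by omega) b (by omega) hab
    _ ≤ _ := Finset.sum_le_sum_of_subset_of_nonneg (Finset.subset_univ _) fun u _ _ =>
        Finset.sum_nonneg fun v _ => mul_nonneg (aA_nonneg G _ _) (sq_nonneg _)

lemma main_lower [Nontrivial V] (G : SimpleGraph V) (hG : G.Connected) (hD : ∀ u, 0 < dD G u)
    (hm : (numEdges G : ℝ) ≠ 0) (x : V) (t : ℕ) (d : ℝ) (hd0 : 0 < d) (hd : ∀ u, d ≤ dD G u)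
    (hM : 16 ≤ d * hH G x t x) :
    d ^ 2 * (hH G x t x) ^ 3 / 192 ≤ ipD G (hH G x t) (hH G x t) := by
  set h := hH G x t with hh
  set M := h x with hMdef
  have hMpos : 0 < M := by
    by_contra hc
    push Not at hc
    nlinarith
  have hE : ∑ u, ∑ v, aA G u v * (h u - h v) ^ 2 ≤ 4 * M := by
    rw [dirichlet G hD]
    have := energy_h G hD hm x t
    linarith
  obtain ⟨y, hy⟩ : ∃ y, h y ≤ 0 := by
    by_contra hc
    push Not at hc
    have h1 := sum_dh G hD hm x t
    have h2 : 0 < ∑ u, dD G u * h u :=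
      Finset.sum_pos (fun u _ => mul_pos (hD u) (hc u)) ⟨x, Finset.mem_univ _⟩
    linarith
  obtain ⟨z, hz0, hzL, hdist, hadj⟩ := geodesic G hG x y
  set L := G.dist x y with hL
  have hinj : ∀ i ≤ L, ∀ j ≤ L, z i = z j → i = j := by
    intro i hi j hj hij
    have h1 := hdist i hi
    have h2 := hdist j hj
    rw [hij] at h1; omega
  have hpb : ∀ i ≤ L, (M - h (z i)) ^ 2 ≤ i * (4 * M) := by
    intro i hi
    have := path_bound G h z L hinj hadj i hi
    rw [hz0] at this
    exact this.trans (mul_le_mul_of_nonneg_left hE (Nat.cast_nonneg _))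
  have hLM : M ≤ 4 * L := by
    have := hpb L le_rfl
    rw [hzL] at this
    have : M ^ 2 ≤ L * (4 * M) := by nlinarith
    by_contra hc
    push Not at hc
    nlinarith
  have hhalf : ∀ i : ℕ, (16 * i : ℝ) ≤ M → i ≤ L ∧ M / 2 ≤ h (z i) := by
    intro i hi
    have hiL : i ≤ L := by
      have : (i:ℝ) ≤ L := by
        have : (0:ℝ) ≤ i := Nat.cast_nonneg _
        linarith
      exact_mod_cast this
    refine ⟨hiL, ?_⟩
    have := hpb i hiL
    by_contra hc
    push Not at hc
    nlinarith
  have hnb : ∀ u, M / 2 ≤ h u → d * M ^ 2 / 4 ≤ ∑ v, aA G u v * h v ^ 2 := by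
    intro u hu
    have h1 := nbr_sum G hD x t u
    rw [← hh] at h1
    have h2 : dD G u * (M / 2) ≤ ∑ v, aA G u v * h v := by
      refine le_trans ?_ h1
      split_ifs with e
      · subst e
        have := hd u
        rw [← hMdef]
        nlinarith
      · have := hD u
        nlinarith
    have h3 : (∑ v, aA G u v * h v) ^ 2 ≤ dD G u * ∑ v, aA G u v * h v ^ 2 := by
      rw [dD_eq]
      refine Finset.sum_sq_le_sum_mul_sum_of_sq_eq_mul _ (fun v _ => aA_nonneg G u v)
        (fun v _ => mul_nonneg (aA_nonneg G u v) (sq_nonneg _)) (fun v _ => by ring)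
    have h4 : (dD G u * (M / 2)) ^ 2 ≤ dD G u * ∑ v, aA G u v * h v ^ 2 :=
      le_trans (pow_le_pow_left₀ (mul_nonneg (hD u).le (by linarith)) h2 2) h3
    have h5 : dD G u * (M / 2) ^ 2 ≤ ∑ v, aA G u v * h v ^ 2 := by
      refine le_of_mul_le_mul_left ?_ (hD u)
      linarith
    have := hd u
    nlinarith [sq_nonneg M]
  let N := ⌊M / 48⌋₊ + 1
  have hN1 : M / 48 ≤ N := by
    have := Nat.lt_floor_add_one (M / 48)
    simp only [N]; push_cast; exact this.le
  have hj : ∀ j ∈ Finset.range N, 3 * j ≤ L ∧ M / 2 ≤ h (z (3 * j)) := by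
    intro j hj
    apply hhalf
    have h1 : j ≤ ⌊M / 48⌋₊ := by
      have := Finset.mem_range.1 hj
      omega
    have h2 : (j:ℝ) ≤ M / 48 := (Nat.le_floor_iff (by positivity)).1 h1
    push_cast; linarith
  have hdis : ∀ w, ∑ j ∈ Finset.range N, aA G (z (3 * j)) w ≤ 1 := by
    intro w
    unfold aA
    rw [Finset.sum_boole]
    have : (Finset.filter (fun j => G.Adj (z (3 * j)) w) (Finset.range N)).card ≤ 1 := by
      rw [Finset.card_le_one]
      intro a ha b hb
      rw [Finset.mem_filter] at ha hb
      have a1 := hdist _ (hj a ha.1).1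
      have b1 := hdist _ (hj b hb.1).1
      have da := SimpleGraph.dist_eq_one_iff_adj.2 ha.2
      have db := SimpleGraph.dist_eq_one_iff_adj.2 hb.2
      have da' := SimpleGraph.dist_eq_one_iff_adj.2 ha.2.symm
      have db' := SimpleGraph.dist_eq_one_iff_adj.2 hb.2.symm
      have t1 := hG.dist_triangle (u := x) (v := z (3*a)) (w := w)
      have t2 := hG.dist_triangle (u := x) (v := w) (w := z (3*a))
      have t3 := hG.dist_triangle (u := x) (v := z (3*b)) (w := w)
      have t4 := hG.dist_triangle (u := x) (v := w) (w := z (3*b))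
      omega
    exact_mod_cast this
  have hfin : (N:ℝ) * (d * M ^ 2 / 4) ≤ ∑ w, h w ^ 2 := by
    calc (N:ℝ) * (d * M ^ 2 / 4) = ∑ j ∈ Finset.range N, d * M ^ 2 / 4 := by simp
      _ ≤ ∑ j ∈ Finset.range N, ∑ w, aA G (z (3 * j)) w * h w ^ 2 :=
        Finset.sum_le_sum fun j hj' => hnb _ (hj j hj').2
      _ = ∑ w, (∑ j ∈ Finset.range N, aA G (z (3 * j)) w) * h w ^ 2 := by
        rw [Finset.sum_comm]; simp_rw [Finset.sum_mul]
      _ ≤ ∑ w, h w ^ 2 := Finset.sum_le_sum fun w _ =>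
        mul_le_of_le_one_left (sq_nonneg _) (hdis w)
  calc d ^ 2 * M ^ 3 / 192 = d * ((M / 48) * (d * M ^ 2 / 4)) := by ring
    _ ≤ d * (N * (d * M ^ 2 / 4)) := by gcongr
    _ ≤ d * ∑ w, h w ^ 2 := by gcongr
    _ ≤ ipD G h h := by
      unfold ipD
      rw [Finset.mul_sum]
      refine Finset.sum_le_sum fun w _ => ?_
      have := hd w
      nlinarith [sq_nonneg (h w)]

end helpers

/-- For a finite connected graph `G` with `m` edges, minimum degree `d`,
lazy random walk with relaxation time `t_rel`, every vertex `x` and every `t ≥ 1`: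
`t²/(2m) ≤ E_x[𝓘_t] ≤ t²/(2m) + 16 t_rel^{3/2} / d`. -/
theorem expected_weighted_intersections_bounds
    {V : Type} [Fintype V] [Nontrivial V] (G : SimpleGraph V) (hG : G.Connected)
    (x : V) (t : ℕ) (ht : 1 ≤ t) :
    (t : ℝ) ^ 2 / (2 * (numEdges G : ℝ)) ≤ EI G x t ∧
      EI G x t ≤ (t : ℝ) ^ 2 / (2 * (numEdges G : ℝ)) +
        16 * (relTime (lazyP G) : ℝ) ^ ((3 : ℝ) / 2) / (G.minDegree : ℝ) := by
  have hD := dD_pos G hG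
  have hm : (0:ℝ) < 2 * (numEdges G : ℝ) := by
    rw [← sum_dD]
    exact Finset.sum_pos (fun u _ => hD u) ⟨x, Finset.mem_univ _⟩
  have hm' : (numEdges G : ℝ) ≠ 0 := by intro h; rw [h] at hm; simp at hm
  rw [EI_h G hD hm' x t]
  refine ⟨by have := ip_nonneg G hD (hH G x t); linarith, ?_⟩
  have hd : ∀ u, (G.minDegree : ℝ) ≤ dD G u := fun u => by
    unfold dD; exact_mod_cast G.minDegree_le_degree u
  have hd0 : (0:ℝ) < G.minDegree := by
    obtain ⟨v, hv⟩ := G.exists_minimal_degree_vertex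
    rw [hv]; exact hD v
  have hT : (1:ℝ) ≤ relTime (lazyP G) := by exact_mod_cast relTime_pos G hD
  have hp := poincare' G hG hD (hH G x t) (sum_dh G hD hm' x t)
  have he := energy_h G hD hm' x t
  have hml := main_lower G hG hD hm' x t G.minDegree hd0 hd
  generalize (relTime (lazyP G) : ℝ) = T at *
  generalize (G.minDegree : ℝ) = d at *
  generalize hH G x t x = M at *
  have hTM := hp.trans (mul_le_mul_of_nonneg_left he (by linarith))
  generalize ipD G (hH G x t) (hH G x t) = I at *
  have hT0 : 0 < T := by linarith
  have hr : T ^ ((3:ℝ)/2) = T * √T := by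
    rw [Real.sqrt_eq_rpow, show (3:ℝ)/2 = 1 + 1/2 by norm_num, Real.rpow_add hT0, Real.rpow_one]
  have hs1 : 1 ≤ √T := Real.one_le_sqrt.2 hT
  have hs2 : √T * √T = T := Real.mul_self_sqrt hT0.le
  have hMle : d * M ≤ 16 * √T := by
    by_contra hc
    push Not at hc
    have h1 := hml (by linarith)
    have hM : 0 < M := by
      by_contra hM
      push Not at hM
      nlinarith
    have h2 : d ^ 2 * M ^ 2 ≤ 192 * T := by
      refine le_of_mul_le_mul_right ?_ hM
      nlinarith
    have h3 : (16 * √T) ^ 2 ≤ (d * M) ^ 2 := pow_le_pow_left₀ (by positivity) hc.le 2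
    nlinarith
  have : I ≤ 16 * T ^ ((3:ℝ)/2) / d := by
    rw [hr, le_div_iff₀ hd0]
    nlinarith
  linarith
end

section
/- Let G=(V,E) be a finite connected graph and let 𝓘_t be the weighted number of intersections of two independent lazy random walks started at the same vertex. For every vertex x and every integer t ≥ 1, E_x[𝓘_t²] ≤ 4·(max_{a∈V} E_a[𝓘_t])·E_x[𝓘_t]. -/
open Finset
open scoped Classical BigOperators

namespace SMI

variable {V : Type} [Fintype V] [Nonempty V]

noncomputable def E1 (P : Matrix V V ℝ) (x : V) (t : ℕ) (F : (Fin t → V) → ℝ) : ℝ :=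
  ∑ p : Fin t → V, pathWeight P x t p * F p

noncomputable def N {t : ℕ} (p : Fin t → V) (u : V) : ℝ :=
  ∑ i ∈ Finset.range t, if traj p i = u then (1 : ℝ) else 0

lemma traj_cons_zero {t : ℕ} (a : V) (p : Fin t → V) :
    traj (Fin.cons a p : Fin (t + 1) → V) 0 = a := by
  simp [traj]

lemma traj_cons_succ {t : ℕ} (a : V) (p : Fin t → V) (i : ℕ) :
    traj (Fin.cons a p : Fin (t + 1) → V) (i + 1) = traj p i := by
  unfold traj
  by_cases h : i < t
  · have h2 : i + 1 < t + 1 := by omega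
    rw [dif_pos h, dif_pos h2]
    exact Fin.cons_succ (α := fun _ => V) a p ⟨i, h⟩
  · have h2 : ¬ i + 1 < t + 1 := by omega
    rw [dif_neg h, dif_neg h2]

lemma N_cons {t : ℕ} (a : V) (p : Fin t → V) (u : V) :
    N (Fin.cons a p : Fin (t + 1) → V) u = (if a = u then 1 else 0) + N p u := by
  unfold N
  rw [Finset.sum_range_succ', add_comm, traj_cons_zero]
  simp_rw [traj_cons_succ]

lemma pw_cons (P : Matrix V V ℝ) (x a : V) (s : ℕ) (p : Fin (s + 1) → V) :
    pathWeight P x (s + 2) (Fin.cons a p : Fin (s + 2) → V) =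
      (if a = x then 1 else 0) * ∑ y, P a y * pathWeight P y (s + 1) p := by
  unfold pathWeight
  rw [traj_cons_zero]
  have h1 : s + 2 - 1 = s + 1 := rfl
  have h2 : s + 1 - 1 = s := rfl
  rw [h1, h2, Finset.prod_range_succ', traj_cons_zero]
  simp_rw [traj_cons_succ]
  simp [mul_comm]

lemma E1_succ (P : Matrix V V ℝ) (x : V) (s : ℕ) (F : (Fin (s + 2) → V) → ℝ) :
    E1 P x (s + 2) F = ∑ y, P x y * E1 P y (s + 1) (fun p => F (Fin.cons x p)) := by
  unfold E1
  rw [← (Fin.consEquiv (fun _ : Fin (s + 2) => V)).sum_comp, Fintype.sum_prod_type]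
  simp only [Fin.consEquiv, Equiv.coe_fn_mk]
  simp_rw [pw_cons]
  rw [Finset.sum_eq_single x]
  · simp only [if_true, one_mul, Finset.sum_mul, Finset.mul_sum]
    rw [Finset.sum_comm]
    simp_rw [mul_assoc]
  · intro b _ hb
    simp [hb]
  · simp

lemma E1_one (P : Matrix V V ℝ) (x : V) (F : (Fin 1 → V) → ℝ) :
    E1 P x 1 F = F (fun _ => x) := by
  unfold E1
  rw [← (Equiv.funUnique (Fin 1) V).symm.sum_comp]
  rw [Finset.sum_eq_single x]
  · simp [pathWeight, traj]
    rfl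
  · intro b _ hb
    simp [pathWeight, traj, hb]
  · simp

lemma N_one (x u : V) : N (fun _ : Fin 1 => x) u = if x = u then 1 else 0 := by
  unfold N
  rw [Finset.sum_range_one]
  simp [traj]

lemma N_nonneg {t : ℕ} (p : Fin t → V) (u : V) : 0 ≤ N p u :=
  Finset.sum_nonneg fun i _ => by split_ifs <;> norm_num

lemma pw_nonneg {P : Matrix V V ℝ} (hP : ∀ u v, 0 ≤ P u v) (x : V) (t : ℕ) (p : Fin t → V) :
    0 ≤ pathWeight P x t p := by
  unfold pathWeight
  exact mul_nonneg (by split_ifs <;> norm_num) (Finset.prod_nonneg fun i _ => hP _ _)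

lemma E1_nonneg {P : Matrix V V ℝ} (hP : ∀ u v, 0 ≤ P u v) (x : V) (t : ℕ)
    (F : (Fin t → V) → ℝ) (hF : ∀ p, 0 ≤ F p) : 0 ≤ E1 P x t F :=
  Finset.sum_nonneg fun p _ => mul_nonneg (pw_nonneg hP x t p) (hF p)

lemma E1_add (P : Matrix V V ℝ) (x : V) (t : ℕ) (F H : (Fin t → V) → ℝ) :
    E1 P x t (fun p => F p + H p) = E1 P x t F + E1 P x t H := by
  simp [E1, mul_add, Finset.sum_add_distrib]

lemma E1_mul (P : Matrix V V ℝ) (x : V) (t : ℕ) (c : ℝ) (F : (Fin t → V) → ℝ) :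
    E1 P x t (fun p => c * F p) = c * E1 P x t F := by
  simp only [E1, Finset.mul_sum]
  exact Finset.sum_congr rfl fun _ _ => by ring

lemma E1_const {P : Matrix V V ℝ} (h1 : ∀ u, ∑ v, P u v = 1) (s : ℕ) (c : ℝ) :
    ∀ x, E1 P x (s + 1) (fun _ => c) = c := by
  induction s with
  | zero => intro x; exact E1_one P x _
  | succ s ih =>
    intro x
    rw [E1_succ]
    simp_rw [ih]
    rw [← Finset.sum_mul, h1, one_mul]

noncomputable def g (P : Matrix V V ℝ) (t : ℕ) (x u : V) : ℝ := E1 P x t (fun p => N p u)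
noncomputable def M (P : Matrix V V ℝ) (t : ℕ) (x u v : V) : ℝ :=
  E1 P x t (fun p => N p u * N p v)

lemma g_nonneg {P : Matrix V V ℝ} (hP : ∀ u v, 0 ≤ P u v) (t : ℕ) (x u : V) : 0 ≤ g P t x u :=
  E1_nonneg hP _ _ _ fun _ => N_nonneg _ _

lemma M_nonneg {P : Matrix V V ℝ} (hP : ∀ u v, 0 ≤ P u v) (t : ℕ) (x u v : V) :
    0 ≤ M P t x u v :=
  E1_nonneg hP _ _ _ fun _ => mul_nonneg (N_nonneg _ _) (N_nonneg _ _)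

lemma g_one (P : Matrix V V ℝ) (x u : V) : g P 1 x u = if x = u then 1 else 0 := by
  rw [g, E1_one, N_one]

lemma g_succ {P : Matrix V V ℝ} (h1 : ∀ u, ∑ v, P u v = 1) (s : ℕ) (x u : V) :
    g P (s + 2) x u = (if x = u then 1 else 0) + ∑ y, P x y * g P (s + 1) y u := by
  unfold g
  rw [E1_succ]
  simp_rw [N_cons, E1_add, E1_const h1, mul_add, Finset.sum_add_distrib]
  rw [← Finset.sum_mul, h1, one_mul]

lemma M_succ {P : Matrix V V ℝ} (h1 : ∀ u, ∑ v, P u v = 1) (s : ℕ) (x u v : V) :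
    M P (s + 2) x u v = (if x = u then 1 else 0) * (if x = v then 1 else 0)
      + (if x = u then 1 else 0) * ∑ y, P x y * g P (s + 1) y v
      + (if x = v then 1 else 0) * ∑ y, P x y * g P (s + 1) y u
      + ∑ y, P x y * M P (s + 1) y u v := by
  unfold M
  rw [E1_succ]
  have key : ∀ (a b : ℝ) (y : V), E1 P y (s + 1) (fun p => (a + N p u) * (b + N p v)) =
      a * b + a * g P (s + 1) y v + b * g P (s + 1) y u
        + E1 P y (s + 1) (fun p => N p u * N p v) := by
    intro a b y
    have : (fun p : Fin (s + 1) → V => (a + N p u) * (b + N p v)) =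
        fun p => ((a * b + a * N p v) + b * N p u) + N p u * N p v := by
      funext p; ring
    rw [this]
    simp_rw [E1_add, E1_mul]
    rw [E1_const h1]
    rfl
  simp_rw [N_cons, key, mul_add, Finset.sum_add_distrib]
  rw [← Finset.sum_mul, h1, one_mul, Finset.mul_sum, Finset.mul_sum]
  congr 1
  congr 1
  · congr 1
    exact Finset.sum_congr rfl fun _ _ => by ring
  · exact Finset.sum_congr rfl fun _ _ => by ring

lemma g_mono {P : Matrix V V ℝ} (hP : ∀ u v, 0 ≤ P u v) (h1 : ∀ u, ∑ v, P u v = 1) (s : ℕ) :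
    ∀ x u, g P (s + 1) x u ≤ g P (s + 2) x u := by
  induction s with
  | zero =>
    intro x u
    rw [g_succ h1, g_one]
    have : 0 ≤ ∑ y, P x y * g P (0 + 1) y u :=
      Finset.sum_nonneg fun y _ => mul_nonneg (hP _ _) (g_nonneg hP _ _ _)
    linarith
  | succ s ih =>
    intro x u
    rw [g_succ h1, g_succ h1]
    have : ∑ y, P x y * g P (s + 1) y u ≤ ∑ y, P x y * g P (s + 1 + 1) y u :=
      Finset.sum_le_sum fun y _ => mul_le_mul_of_nonneg_left (ih _ _) (hP _ _)
    linarith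

lemma M_le {P : Matrix V V ℝ} (hP : ∀ u v, 0 ≤ P u v) (h1 : ∀ u, ∑ v, P u v = 1) (s : ℕ) :
    ∀ x u v, M P (s + 1) x u v ≤
      g P (s + 1) x u * g P (s + 1) u v + g P (s + 1) x v * g P (s + 1) v u := by
  induction s with
  | zero =>
    intro x u v
    simp only [zero_add]
    rw [M, E1_one, N_one, N_one, g_one, g_one, g_one, g_one]
    by_cases h : x = u
    · subst h
      by_cases h2 : x = v
      · subst h2; simp
      · simp [h2]
    · by_cases h2 : x = v
      · subst h2; simp [h, Ne.symm h]
      · simp [h, h2]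
  | succ s ih =>
    intro x u v
    show M P (s + 2) x u v ≤ 
      g P (s + 2) x u * g P (s + 2) u v + g P (s + 2) x v * g P (s + 2) v u
    rw [M_succ h1]
    have hA : ∑ y, P x y * M P (s + 1) y u v ≤
        (∑ y, P x y * g P (s + 1) y u) * g P (s + 2) u v
        + (∑ y, P x y * g P (s + 1) y v) * g P (s + 2) v u := by
      rw [Finset.sum_mul, Finset.sum_mul, ← Finset.sum_add_distrib]
      refine Finset.sum_le_sum fun y _ => ?_
      rw [mul_assoc, mul_assoc, ← mul_add]
      refine mul_le_mul_of_nonneg_left ((ih y u v).trans ?_) (hP _ _)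
      exact add_le_add
        (mul_le_mul_of_nonneg_left (g_mono hP h1 s _ _) (g_nonneg hP _ _ _))
        (mul_le_mul_of_nonneg_left (g_mono hP h1 s _ _) (g_nonneg hP _ _ _))
    have hB : (if x = u then (1:ℝ) else 0) * (if x = v then 1 else 0)
        + (if x = u then 1 else 0) * ∑ y, P x y * g P (s + 1) y v
        = (if x = u then 1 else 0) * g P (s + 2) u v := by
      by_cases h : x = u
      · subst h; rw [g_succ h1 s x v]; simp
      · simp [h]
    have hC : (if x = v then (1:ℝ) else 0) * ∑ y, P x y * g P (s + 1) y u
        ≤ (if x = v then 1 else 0) * g P (s + 2) v u := by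
      by_cases h : x = v
      · subst h; rw [g_succ h1 s x u]; simp; split_ifs <;> norm_num
      · simp [h]
    rw [hB, g_succ h1 s x u, g_succ h1 s x v, add_mul, add_mul]
    linarith

lemma wInter_eq (G : SimpleGraph V) {t : ℕ} (p q : Fin t → V) :
    wInter G p q = ∑ u, 1 / (G.degree u : ℝ) * (N p u * N q u) := by
  unfold wInter wInterIco N
  simp_rw [Finset.sum_mul_sum, Finset.mul_sum, ← Finset.range_eq_Ico]
  conv_rhs => rw [Finset.sum_comm]
  refine Finset.sum_congr rfl fun i _ => ?_
  conv_rhs => rw [Finset.sum_comm]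
  refine Finset.sum_congr rfl fun j _ => ?_
  rw [Finset.sum_eq_single (traj p i)]
  · by_cases h : traj p i = traj q j
    · simp [h]
    · simp [h, Ne.symm h]
  · intro b _ hb
    simp [Ne.symm hb]
  · simp

lemma E2_mul (P : Matrix V V ℝ) (x : V) (t : ℕ) {ι : Type} [Fintype ι] (c : ι → ℝ)
    (A : ι → (Fin t → V) → ℝ) :
    E2 P x x t (fun p q => ∑ i, c i * (A i p * A i q)) = ∑ i, c i * (E1 P x t (A i)) ^ 2 := by
  unfold E2 E1
  simp_rw [sq, Finset.sum_mul_sum, Finset.mul_sum]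
  conv_rhs => rw [Finset.sum_comm]
  refine Finset.sum_congr rfl fun p _ => ?_
  conv_rhs => rw [Finset.sum_comm]
  exact Finset.sum_congr rfl fun q _ => Finset.sum_congr rfl fun i _ => by ring

lemma EI_eq (G : SimpleGraph V) (x : V) (t : ℕ) :
    EI G x t = ∑ u, 1 / (G.degree u : ℝ) * (g (lazyP G) t x u) ^ 2 := by
  unfold EI EIxy
  simp_rw [wInter_eq]
  exact E2_mul (lazyP G) x t (fun u => 1 / (G.degree u : ℝ)) (fun u p => N p u)

lemma EIsq_eq (G : SimpleGraph V) (x : V) (t : ℕ) :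
    EIsq G x t = ∑ u, ∑ v, 1 / (G.degree u : ℝ) * (1 / (G.degree v : ℝ)) *
      (M (lazyP G) t x u v) ^ 2 := by
  unfold EIsq
  have : (fun p q : Fin t → V => wInter G p q ^ 2) = fun p q => ∑ i : V × V,
      (1 / (G.degree i.1 : ℝ) * (1 / (G.degree i.2 : ℝ))) *
        ((N p i.1 * N p i.2) * (N q i.1 * N q i.2)) := by
    funext p q
    rw [wInter_eq, sq, Finset.sum_mul_sum, Fintype.sum_prod_type]
    exact Finset.sum_congr rfl fun _ _ => Finset.sum_congr rfl fun _ _ => by ring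
  rw [this, E2_mul (lazyP G) x t
    (fun i : V × V => 1 / (G.degree i.1 : ℝ) * (1 / (G.degree i.2 : ℝ)))
    (fun i p => N p i.1 * N p i.2), Fintype.sum_prod_type]
  rfl

lemma lazyP_nonneg (G : SimpleGraph V) (u v : V) : 0 ≤ lazyP G u v := by
  unfold lazyP
  split_ifs <;> positivity

lemma lazyP_sum (G : SimpleGraph V) (u : V) (hu : 0 < G.degree u) :
    ∑ v, lazyP G u v = 1 := by
  have h : ∀ v, lazyP G u v = (if u = v then 1 / 2 else 0)
      + (if G.Adj u v then 1 / (2 * (G.degree u : ℝ)) else 0) := by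
    intro v
    unfold lazyP
    by_cases h : u = v
    · subst h; simp
    · simp [h]
  simp_rw [h]
  rw [Finset.sum_add_distrib, ← Finset.sum_filter (fun v => G.Adj u v), Finset.sum_const,
    ← SimpleGraph.neighborFinset_eq_filter, SimpleGraph.card_neighborFinset_eq_degree]
  have : (G.degree u : ℝ) ≠ 0 := by positivity
  simp
  field_simp
  norm_num

end SMI

/-- For a finite connected graph `G`, every vertex `x` and every `t ≥ 1`:
`E_x[𝓘_t²] ≤ 4 (max_{a ∈ V} E_a[𝓘_t]) E_x[𝓘_t]`. -/
theorem second_moment_intersections_bound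
    {V : Type} [Fintype V] [Nontrivial V] (G : SimpleGraph V) (hG : G.Connected)
    (x : V) (t : ℕ) (ht : 1 ≤ t) :
    EIsq G x t ≤ 4 * (⨆ a : V, EI G a t) * EI G x t := by
  obtain ⟨s, rfl⟩ : ∃ s, t = s + 1 := ⟨t - 1, by omega⟩
  have hP := SMI.lazyP_nonneg G
  have h1 : ∀ u, ∑ v, lazyP G u v = 1 := fun u =>
    SMI.lazyP_sum G u (hG.preconnected.degree_pos_of_nontrivial u)
  set S := ⨆ a : V, EI G a (s + 1) with hS
  have hle : ∀ a, EI G a (s + 1) ≤ S := fun a => by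
    rw [hS]
    exact le_ciSup (f := fun a : V => EI G a (s + 1)) (Set.finite_range _).bddAbove a
  have hd : ∀ u : V, 0 ≤ 1 / (G.degree u : ℝ) := fun u => by positivity
  set gg := SMI.g (lazyP G) (s + 1) with hgg
  set d : V → ℝ := fun u => 1 / (G.degree u : ℝ) with hdd
  have hT : ∑ u, ∑ v, d u * d v * (gg x u * gg u v) ^ 2 ≤ S * EI G x (s + 1) := by
    rw [SMI.EI_eq G x, Finset.mul_sum]
    refine Finset.sum_le_sum fun u _ => ?_
    have h2 := hle u
    rw [SMI.EI_eq G u] at h2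
    have h3 : ∑ v, d u * d v * (gg x u * gg u v) ^ 2
        = (∑ v, d v * gg u v ^ 2) * (d u * gg x u ^ 2) := by
      rw [Finset.sum_mul]
      exact Finset.sum_congr rfl fun _ _ => by ring
    rw [h3]
    exact mul_le_mul_of_nonneg_right h2 (mul_nonneg (hd u) (sq_nonneg _))
  have hT2 : ∑ u, ∑ v, d u * d v * (gg x v * gg v u) ^ 2 ≤ S * EI G x (s + 1) := by
    rw [Finset.sum_comm]
    refine le_trans (le_of_eq ?_) hT
    exact Finset.sum_congr rfl fun _ _ => Finset.sum_congr rfl fun _ _ => by ring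
  have hmain : EIsq G x (s + 1) ≤ ∑ u, ∑ v, (2 * (d u * d v * (gg x u * gg u v) ^ 2)
      + 2 * (d u * d v * (gg x v * gg v u) ^ 2)) := by
    rw [SMI.EIsq_eq]
    refine Finset.sum_le_sum fun u _ => Finset.sum_le_sum fun v _ => ?_
    have hM := SMI.M_le hP h1 s x u v
    have hM0 := SMI.M_nonneg hP (s + 1) x u v
    have hsq : SMI.M (lazyP G) (s + 1) x u v ^ 2 ≤
        2 * (gg x u * gg u v) ^ 2 + 2 * (gg x v * gg v u) ^ 2 := by
      refine (pow_le_pow_left₀ hM0 hM 2).trans ?_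
      nlinarith [sq_nonneg (gg x u * gg u v - gg x v * gg v u)]
    have := mul_le_mul_of_nonneg_left hsq (mul_nonneg (hd u) (hd v))
    refine this.trans (le_of_eq ?_)
    simp only [hdd]
    ring
  simp only [Finset.sum_add_distrib, ← Finset.mul_sum] at hmain
  linarith
end

section
/- There is a universal constant C > 0 such that for every finite connected graph G=(V,E) with n vertices, m edges and relaxation time t_rel, for every vertex x and integer t ≥ 1, the second moment of the weighted number of intersections counted from the uniform mixing time satisfies E_x[𝓙_t²] ≤ C·(t²/m²)·(t² + n·t_rel^{5/3}). -/
open Finset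
open scoped Classical BigOperators

set_option linter.unusedSectionVars false
set_option linter.unusedSimpArgs false

section PathStuff
variable {V : Type} [Fintype V] [Nonempty V]

lemma aux_traj_cons_zero {N : ℕ} (y : V) (p : Fin N → V) :
    traj (Fin.cons y p : Fin (N+1) → V) 0 = y := by
  simp [traj]

lemma aux_traj_cons_succ {N : ℕ} (y : V) (p : Fin N → V) (i : ℕ) :
    traj (Fin.cons y p : Fin (N+1) → V) (i+1) = traj p i := by
  unfold traj
  by_cases h : i < N
  · have h' : i + 1 < N + 1 := by omega
    rw [dif_pos h, dif_pos h']
    exact Fin.cons_succ (α := fun _ => V) y p ⟨i, h⟩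
  · have h' : ¬ (i + 1 < N + 1) := by omega
    rw [dif_neg h, dif_neg h']

lemma aux_weight_cons (P : Matrix V V ℝ) (x y : V) (N : ℕ) (p : Fin (N+1) → V) :
    pathWeight P x (N+2) (Fin.cons y p) =
      (if y = x then 1 else 0) * (P y (traj p 0) * ∏ i ∈ Finset.range N, P (traj p i) (traj p (i+1))) := by
  unfold pathWeight
  rw [aux_traj_cons_zero]
  congr 1
  rw [show N + 2 - 1 = N + 1 from rfl, Finset.prod_range_succ']
  simp only [aux_traj_cons_succ, aux_traj_cons_zero]
  rw [mul_comm]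


lemma aux_sum_cons {N : ℕ} (F : (Fin (N+1) → V) → ℝ) :
    ∑ p, F p = ∑ y, ∑ p : Fin N → V, F (Fin.cons y p) := by
  rw [← Fintype.sum_prod_type']
  exact ((Fin.consEquiv (fun _ : Fin (N+1) => V)).sum_comp F).symm

lemma aux_markov (P : Matrix V V ℝ) (x : V) (N : ℕ) (Φ : (Fin (N+2) → V) → ℝ) :
    ∑ p, pathWeight P x (N+2) p * Φ p =
      ∑ y, P x y * ∑ p : Fin (N+1) → V, pathWeight P y (N+1) p * Φ (Fin.cons x p) := by
  rw [aux_sum_cons (fun p => pathWeight P x (N+2) p * Φ p)]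
  simp only [aux_weight_cons]
  rw [Finset.sum_eq_single x]
  · simp only [if_true, one_mul, pathWeight, Finset.mul_sum]
    rw [Finset.sum_comm]
    refine Finset.sum_congr rfl fun p _ => ?_
    rw [Finset.sum_eq_single (traj p 0)]
    · simp [mul_assoc]
    · intro b _ hb
      simp [Ne.symm hb]
    · simp
  · intro b _ hb
    simp [hb]
  · simp

lemma aux_one (P : Matrix V V ℝ) (x : V) (Φ : (Fin 1 → V) → ℝ) :
    ∑ p, pathWeight P x 1 p * Φ p = Φ (fun _ => x) := by
  rw [← (Equiv.funUnique (Fin 1) V).symm.sum_comp, Finset.sum_eq_single x]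
  · have : (Equiv.funUnique (Fin 1) V).symm x = fun _ => x := by ext i; simp
    rw [this]; simp [pathWeight, traj]
  · intro b _ hb
    simp [pathWeight, traj, hb]
  · simp

lemma aux_zero_time (P : Matrix V V ℝ) (x : V) (N : ℕ) (p : Fin (N+1) → V) (h : V → ℝ) :
    pathWeight P x (N+1) p * h (traj p 0) = pathWeight P x (N+1) p * h x := by
  unfold pathWeight
  by_cases hx : traj p 0 = x
  · rw [hx]
  · simp [hx]

lemma aux_total (P : Matrix V V ℝ) (hP : ∀ x, ∑ y, P x y = 1) (N : ℕ) : ∀ x,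
    ∑ p, pathWeight P x (N+1) p = 1 := by
  induction N with
  | zero => intro x; simpa using aux_one P x (fun _ => 1)
  | succ N ih =>
    intro x
    have := aux_markov P x N (fun _ => 1)
    simp only [mul_one] at this
    rw [this]
    simp [ih, hP]

lemma aux_onept (P : Matrix V V ℝ) (hP : ∀ x, ∑ y, P x y = 1) (v : V) (k : ℕ) :
    ∀ (N : ℕ) (x : V), k ≤ N →
    ∑ p, pathWeight P x (N+1) p * (if traj p k = v then 1 else 0) = (P ^ k) x v := by
  induction k with
  | zero =>
    intro N x _
    simp only [aux_zero_time P x N _ (fun z => if z = v then (1:ℝ) else 0), ← Finset.sum_mul,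
      aux_total P hP, pow_zero, Matrix.one_apply, one_mul]
  | succ k ih =>
    intro N x hN
    obtain ⟨N, rfl⟩ : ∃ M, N = M + 1 := ⟨N-1, by omega⟩
    rw [aux_markov, pow_succ', Matrix.mul_apply]
    refine Finset.sum_congr rfl fun y _ => ?_
    simp only [aux_traj_cons_succ]
    rw [ih N y (by omega)]

lemma aux_twopt (P : Matrix V V ℝ) (hP : ∀ x, ∑ y, P x y = 1) (u v : V) (l : ℕ) (i : ℕ) :
    ∀ (N : ℕ) (x : V), i + l ≤ N →
    ∑ p, pathWeight P x (N+1) p * ((if traj p i = u then 1 else 0) * (if traj p (i+l) = v then 1 else 0))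
      = (P ^ i) x u * (P ^ l) u v := by
  induction i with
  | zero =>
    intro N x hN
    have : ∀ p : Fin (N+1) → V, pathWeight P x (N+1) p * ((if traj p 0 = u then 1 else 0) * (if traj p (0+l) = v then 1 else 0))
       = (if x = u then 1 else 0) * (pathWeight P x (N+1) p * (if traj p l = v then 1 else 0)) := by
      intro p
      rw [← mul_assoc, aux_zero_time P x N p (fun z => if z = u then (1:ℝ) else 0), zero_add]; ring
    rw [Finset.sum_congr rfl fun p _ => this p, ← Finset.mul_sum, aux_onept P hP v l N x (by omega),
      pow_zero, Matrix.one_apply]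
    by_cases hx : x = u <;> simp [hx]
  | succ i ih =>
    intro N x hN
    obtain ⟨N, rfl⟩ : ∃ M, N = M + 1 := ⟨N-1, by omega⟩
    rw [aux_markov, pow_succ', Matrix.mul_apply, Finset.sum_mul]
    refine Finset.sum_congr rfl fun y _ => ?_
    simp only [show i + 1 + l = (i + l) + 1 by ring, aux_traj_cons_succ]
    rw [ih N y (by omega), mul_assoc]

lemma aux_expand_gen {α : Type} [Fintype α] (w : α → ℝ) (a : α → V → ℝ) (c : V → ℝ) :
    ∑ p, ∑ q, w p * w q * (∑ u, c u * a p u * a q u)^2 =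
      ∑ u, ∑ v, c u * c v * (∑ p, w p * (a p u * a p v))^2 := by
  have comm4 : ∀ F : α → α → V → V → ℝ,
      ∑ p, ∑ q, ∑ u, ∑ v, F p q u v = ∑ u, ∑ v, ∑ p, ∑ q, F p q u v := by
    intro F
    calc _ = ∑ p, ∑ u, ∑ q, ∑ v, F p q u v := Finset.sum_congr rfl fun _ _ => Finset.sum_comm
      _ = ∑ u, ∑ p, ∑ q, ∑ v, F p q u v := Finset.sum_comm
      _ = ∑ u, ∑ p, ∑ v, ∑ q, F p q u v :=
        Finset.sum_congr rfl fun _ _ => Finset.sum_congr rfl fun _ _ => Finset.sum_comm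
      _ = _ := Finset.sum_congr rfl fun _ _ => Finset.sum_comm
  calc _ = ∑ p, ∑ q, ∑ u, ∑ v, w p * w q * ((c u * a p u * a q u) * (c v * a p v * a q v)) := by
        refine Finset.sum_congr rfl fun p _ => Finset.sum_congr rfl fun q _ => ?_
        rw [sq, Finset.sum_mul_sum, Finset.mul_sum]
        refine Finset.sum_congr rfl fun u _ => ?_
        rw [Finset.mul_sum]
    _ = _ := by
        rw [comm4]
        refine Finset.sum_congr rfl fun u _ => Finset.sum_congr rfl fun v _ => ?_
        rw [sq, Finset.sum_mul_sum, Finset.mul_sum]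
        refine Finset.sum_congr rfl fun p _ => ?_
        rw [Finset.mul_sum]
        refine Finset.sum_congr rfl fun q _ => ?_
        ring

/-- Expansion of the second moment. -/
lemma aux_expand (P : Matrix V V ℝ) (G : SimpleGraph V) (x : V) (a b t : ℕ) :
    E2 P x x t (fun p q => (wInterIco G a b p q)^2) =
    ∑ u, ∑ v, (1 / (G.degree u : ℝ)) * (1 / (G.degree v : ℝ)) *
      (∑ i ∈ Finset.Ico a b, ∑ k ∈ Finset.Ico a b,
        ∑ p : Fin t → V, pathWeight P x t p *
          ((if traj p i = u then 1 else 0) * (if traj p k = v then 1 else 0)))^2 := by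
  have h1 : ∀ p q : Fin t → V, wInterIco G a b p q = ∑ u, (1 / (G.degree u : ℝ)) *
      (∑ i ∈ Finset.Ico a b, if traj p i = u then 1 else 0) *
      (∑ i ∈ Finset.Ico a b, if traj q i = u then 1 else 0) := by
    intro p q
    unfold wInterIco
    have e : ∀ u : V, (1 / (G.degree u : ℝ)) *
      (∑ i ∈ Finset.Ico a b, if traj p i = u then (1:ℝ) else 0) *
      (∑ i ∈ Finset.Ico a b, if traj q i = u then (1:ℝ) else 0) =
      ∑ i ∈ Finset.Ico a b, ∑ j ∈ Finset.Ico a b, (1 / (G.degree u : ℝ)) *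
        ((if traj p i = u then (1:ℝ) else 0) * (if traj q j = u then (1:ℝ) else 0)) := by
      intro u
      rw [mul_assoc, Finset.sum_mul_sum, Finset.mul_sum]
      refine Finset.sum_congr rfl fun i _ => ?_
      rw [Finset.mul_sum]
    rw [Finset.sum_congr rfl fun u _ => e u]
    symm
    rw [Finset.sum_comm]
    refine Finset.sum_congr rfl fun i _ => ?_
    rw [Finset.sum_comm]
    refine Finset.sum_congr rfl fun j _ => ?_
    rw [Finset.sum_eq_single (traj p i)]
    · by_cases h : traj p i = traj q j
      · simp [h]
      · simp [h, Ne.symm h]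
    · intro b _ hb
      simp [Ne.symm hb]
    · simp
  have h2 : ∀ u v, (∑ i ∈ Finset.Ico a b, ∑ k ∈ Finset.Ico a b,
        ∑ p : Fin t → V, pathWeight P x t p *
          ((if traj p i = u then (1:ℝ) else 0) * (if traj p k = v then 1 else 0)))
      = ∑ p : Fin t → V, pathWeight P x t p *
        ((∑ i ∈ Finset.Ico a b, if traj p i = u then 1 else 0) *
         (∑ i ∈ Finset.Ico a b, if traj p i = v then 1 else 0)) := by
    intro u v
    calc _ = ∑ i ∈ Finset.Ico a b, ∑ p : Fin t → V, ∑ k ∈ Finset.Ico a b, pathWeight P x t p *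
          ((if traj p i = u then (1:ℝ) else 0) * (if traj p k = v then 1 else 0)) :=
          Finset.sum_congr rfl fun _ _ => Finset.sum_comm
      _ = ∑ p : Fin t → V, ∑ i ∈ Finset.Ico a b, ∑ k ∈ Finset.Ico a b, pathWeight P x t p *
          ((if traj p i = u then (1:ℝ) else 0) * (if traj p k = v then 1 else 0)) := Finset.sum_comm
      _ = _ := by
        refine Finset.sum_congr rfl fun p _ => ?_
        rw [Finset.sum_mul_sum, Finset.mul_sum]
        refine Finset.sum_congr rfl fun i _ => ?_
        rw [Finset.mul_sum]
  simp only [h2]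
  unfold E2
  simp only [h1]
  exact aux_expand_gen (fun p => pathWeight P x t p)
    (fun p u => ∑ i ∈ Finset.Ico a b, if traj p i = u then (1:ℝ) else 0) (fun u => 1 / (G.degree u : ℝ))

end PathStuff

section Core
variable {V : Type} [Fintype V]

/-- Energy over ordered pairs. -/
noncomputable def auxEn (G : SimpleGraph V) (f : V → ℝ) : ℝ :=
  ∑ u, ∑ w, if G.Adj u w then (f u - f w)^2 else 0

lemma aux_en_prod (G : SimpleGraph V) (f : V → ℝ) :
    auxEn G f = ∑ e ∈ (Finset.univ : Finset (V × V)).filter (fun e => G.Adj e.1 e.2), (f e.1 - f e.2)^2 := by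
  unfold auxEn
  rw [Finset.sum_filter, ← Fintype.sum_prod_type']

lemma aux_path (G : SimpleGraph V) (hG : G.Connected) (f : V → ℝ) (u v : V) :
    (f v - f u)^2 ≤ (G.dist u v : ℝ) * auxEn G f := by
  obtain ⟨p, hp⟩ := hG.exists_walk_length_eq_dist u v
  have hpath := p.isPath_of_length_eq_dist hp
  have htel : f v - f u = ∑ i ∈ Finset.range p.length, (f (p.getVert (i+1)) - f (p.getVert i)) := by
    rw [Finset.sum_range_sub (fun i => f (p.getVert i))]
    simp
  have h1 : (f v - f u)^2 ≤ (p.length : ℝ) *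
      ∑ i ∈ Finset.range p.length, (f (p.getVert (i+1)) - f (p.getVert i))^2 := by
    rw [htel]
    simpa using sq_sum_le_card_mul_sum_sq (s := Finset.range p.length)
      (f := fun i => f (p.getVert (i+1)) - f (p.getVert i))
  have h2 : ∑ i ∈ Finset.range p.length, (f (p.getVert (i+1)) - f (p.getVert i))^2 ≤ auxEn G f := by
    rw [aux_en_prod]
    have inj : Set.InjOn (fun i => (p.getVert (i+1), p.getVert i)) (Finset.range p.length : Set ℕ) := by
      intro i hi j hj hij
      simp only [Finset.coe_range, Set.mem_Iio] at hi hj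
      have := (Prod.mk.inj hij).2
      exact hpath.getVert_injOn (by simp; omega) (by simp; omega) this
    rw [← Finset.sum_image (s := Finset.range p.length) (g := fun i => (p.getVert (i+1), p.getVert i))
      (f := fun e : V × V => (f e.1 - f e.2)^2) inj]
    apply Finset.sum_le_sum_of_subset_of_nonneg
    · intro e he
      simp only [Finset.mem_image, Finset.mem_range] at he
      obtain ⟨i, hi, rfl⟩ := he
      simp only [Finset.mem_filter, Finset.mem_univ, true_and]
      exact (p.adj_getVert_succ hi).symm
    · intros; positivity
  rw [← hp]
  exact h1.trans (mul_le_mul_of_nonneg_left h2 (by positivity))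

lemma aux_ball_card (G : SimpleGraph V) (hG : G.Connected) (c u : V) (ρ : ℕ) (h : ρ < G.dist c u) :
    (ρ : ℝ) / 4 ≤ ((Finset.univ.filter fun w => 4 * G.dist c w ≤ ρ).card : ℝ) := by
  obtain ⟨p, hp⟩ := hG.exists_walk_length_eq_dist c u
  have hpath := p.isPath_of_length_eq_dist hp
  have hc : (Finset.range (ρ/4+1)).card ≤ (Finset.univ.filter fun w => 4 * G.dist c w ≤ ρ).card := by
    apply Finset.card_le_card_of_injOn (fun i => p.getVert i)
    · intro i hi
      simp only [Finset.coe_range, Set.mem_Iio] at hi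
      simp only [Finset.coe_filter, Finset.mem_univ, true_and, Set.mem_ofPred_eq]
      have : G.dist c (p.getVert i) ≤ (p.take i).length := SimpleGraph.dist_le _
      have h2 : (p.take i).length ≤ i := by simp
      omega
    · intro i hi j hj hij
      simp only [Finset.coe_range, Set.mem_Iio] at hi hj
      exact hpath.getVert_injOn (by simp; omega) (by simp; omega) hij
  rw [Finset.card_range] at hc
  have h4 : ρ ≤ 4 * (Finset.univ.filter fun w => 4 * G.dist c w ≤ ρ).card := by omega
  have : (ρ:ℝ) ≤ 4 * ((Finset.univ.filter fun w => 4 * G.dist c w ≤ ρ).card : ℝ) := by exact_mod_cast h4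
  linarith

lemma aux_cover (G : SimpleGraph V) (hG : G.Connected) (ρ : ℕ) (hρ : 1 ≤ ρ) :
    ∑ v ∈ Finset.univ.filter (fun v => ∃ u, ρ < G.dist v u),
      (G.degree v : ℝ) / ∑ u ∈ Finset.univ.filter (fun u => G.dist v u ≤ ρ), (G.degree u : ℝ)
      ≤ 4 * (Fintype.card V : ℝ) / ρ := by
  set W := Finset.univ.filter (fun v => ∃ u, ρ < G.dist v u) with hW
  let Sep : Finset V → Prop := fun S => S ⊆ W ∧ ∀ a ∈ S, ∀ b ∈ S, a ≠ b → ρ < 2 * G.dist a b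
  obtain ⟨S, hS, hmax⟩ := Finset.exists_max_image (Finset.univ.filter Sep) Finset.card
    ⟨∅, by simp [Sep]⟩
  simp only [Finset.mem_filter, Finset.mem_univ, true_and] at hS hmax
  have hcov : ∀ v ∈ W, ∃ c ∈ S, 2 * G.dist c v ≤ ρ := by
    intro v hv
    by_contra! hcon
    have hvS : v ∉ S := fun h => by have := hcon v h; simp at this
    have := hmax (insert v S) ⟨Finset.insert_subset hv hS.1, by
      intro a ha b hb hab
      rw [Finset.mem_insert] at ha hb
      rcases ha with rfl | ha <;> rcases hb with rfl | hb
      · exact absurd rfl hab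
      · rw [SimpleGraph.dist_comm]; exact hcon b hb
      · exact hcon a ha
      · exact hS.2 a ha b hb hab⟩
    rw [Finset.card_insert_of_notMem hvS] at this
    omega
  let K : V → Finset V := fun c => W.filter (fun v => 2 * G.dist c v ≤ ρ)
  have hnn : ∀ v, 0 ≤ (G.degree v : ℝ) / ∑ u ∈ Finset.univ.filter (fun u => G.dist v u ≤ ρ), (G.degree u : ℝ) :=
    fun v => by positivity
  have hcell : ∀ c ∈ S, ∑ v ∈ K c, (G.degree v : ℝ) /
      ∑ u ∈ Finset.univ.filter (fun u => G.dist v u ≤ ρ), (G.degree u : ℝ) ≤ 1 := by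
    intro c _
    have hk : ∀ v ∈ K c, (G.degree v : ℝ) /
      ∑ u ∈ Finset.univ.filter (fun u => G.dist v u ≤ ρ), (G.degree u : ℝ) ≤
      (G.degree v : ℝ) / ∑ u ∈ K c, (G.degree u : ℝ) := by
      intro v hv
      have hle : ∑ u ∈ K c, (G.degree u : ℝ) ≤ ∑ u ∈ Finset.univ.filter (fun u => G.dist v u ≤ ρ), (G.degree u : ℝ) := by
        apply Finset.sum_le_sum_of_subset_of_nonneg
        · intro u hu
          simp only [K, Finset.mem_filter] at hu hv
          simp only [Finset.mem_filter, Finset.mem_univ, true_and]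
          have := hG.dist_triangle (u := v) (v := c) (w := u)
          rw [SimpleGraph.dist_comm (u := v) (v := c)] at this
          omega
        · intros; positivity
      by_cases h0 : (G.degree v : ℝ) = 0
      · simp [h0]
      have hpos : (0:ℝ) < G.degree v := lt_of_le_of_ne (by positivity) (Ne.symm h0)
      have : (G.degree v : ℝ) ≤ ∑ u ∈ K c, (G.degree u : ℝ) :=
        Finset.single_le_sum (f := fun u => (G.degree u : ℝ)) (fun _ _ => by positivity) hv
      exact div_le_div_of_nonneg_left hpos.le (by linarith) hle
    refine (Finset.sum_le_sum hk).trans ?_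
    rw [← Finset.sum_div]
    exact div_self_le_one _
  have h1 : ∑ v ∈ W, (G.degree v : ℝ) / ∑ u ∈ Finset.univ.filter (fun u => G.dist v u ≤ ρ), (G.degree u : ℝ) ≤ S.card := by
    generalize hF : (fun v => (G.degree v : ℝ) / ∑ u ∈ Finset.univ.filter (fun u => G.dist v u ≤ ρ), (G.degree u : ℝ)) = F at *
    have hF' : ∀ v, (G.degree v : ℝ) / ∑ u ∈ Finset.univ.filter (fun u => G.dist v u ≤ ρ), (G.degree u : ℝ) = F v :=
      fun v => congrFun hF v
    simp only [hF'] at hnn hcell ⊢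
    calc _ ≤ ∑ v ∈ W, ∑ c ∈ S, (if 2 * G.dist c v ≤ ρ then F v else 0) := by
          refine Finset.sum_le_sum fun v hv => ?_
          obtain ⟨c, hc, h⟩ := hcov v hv
          have := Finset.single_le_sum (f := fun c => (if 2 * G.dist c v ≤ ρ then F v else 0))
            (fun c _ => by split_ifs; exacts [hnn v, le_rfl]) hc
          simpa [h] using this
      _ = ∑ c ∈ S, ∑ v ∈ K c, F v := by
          rw [Finset.sum_comm]
          refine Finset.sum_congr rfl fun c _ => ?_
          exact (Finset.sum_filter (s := W) (fun v => 2 * G.dist c v ≤ ρ) F).symm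
      _ ≤ ∑ c ∈ S, 1 := Finset.sum_le_sum hcell
      _ = S.card := by simp
  have h2 : (S.card : ℝ) * (ρ / 4) ≤ Fintype.card V := by
    have hdisj : (S : Set V).PairwiseDisjoint (fun c => Finset.univ.filter fun w => 4 * G.dist c w ≤ ρ) := by
      intro a ha b hb hab
      rw [Function.onFun, Finset.disjoint_left]
      intro w hwa hwb
      simp only [Finset.mem_filter, Finset.mem_univ, true_and] at hwa hwb
      have := hS.2 a ha b hb hab
      have h3 := hG.dist_triangle (u := a) (v := w) (w := b)
      rw [SimpleGraph.dist_comm (u := w)] at h3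
      omega
    have hcard := Finset.card_biUnion (s := S) (t := fun c => Finset.univ.filter fun w => 4 * G.dist c w ≤ ρ) hdisj
    have hle : (S.biUnion fun c => Finset.univ.filter fun w => 4 * G.dist c w ≤ ρ).card ≤ Fintype.card V := Finset.card_le_univ _
    rw [hcard] at hle
    calc (S.card : ℝ) * (ρ / 4) = ∑ c ∈ S, (ρ:ℝ)/4 := by simp
      _ ≤ ∑ c ∈ S, ((Finset.univ.filter fun w => 4 * G.dist c w ≤ ρ).card : ℝ) := by
        refine Finset.sum_le_sum fun c hc => ?_
        have := hS.1 hc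
        simp only [hW, Finset.mem_filter, Finset.mem_univ, true_and] at this
        obtain ⟨u, hu⟩ := this
        exact aux_ball_card G hG c u ρ hu
      _ ≤ _ := by exact_mod_cast hle
  have hρ' : (0:ℝ) < ρ := by exact_mod_cast hρ
  refine h1.trans ?_
  rw [le_div_iff₀ hρ']
  linarith

set_option maxHeartbeats 1000000 in
lemma aux_pointwise (G : SimpleGraph V) (hG : G.Connected) (ρ : ℕ) (hρ : 1 ≤ ρ) (T : ℝ) (hT : 1 ≤ T)
    (v : V) (h : ℝ) (hh : 0 ≤ h) (hd : ∀ u, 0 < G.degree u) (f : V → ℝ) (hM : 0 ≤ f v)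
    (hfv : (f v)^2 * G.degree v = h^2)
    (hmean : ∑ u, (G.degree u : ℝ) * f u = 0) (hen : auxEn G f = 4 * h)
    (hnorm : ∑ u, (G.degree u : ℝ) * (f u)^2 ≤ T * h) :
    h ≤ 16 * (ρ:ℝ)^2 + 32 + 16 * (T / ρ) * (∑ u, if G.Adj v u then 1 / (G.degree u : ℝ) else 0) +
      4 * T * (if ∃ u, ρ < G.dist v u then
        (G.degree v : ℝ) / ∑ u ∈ Finset.univ.filter (fun u => G.dist v u ≤ ρ), (G.degree u : ℝ) else 0) := by
  have hρ' : (1:ℝ) ≤ ρ := by exact_mod_cast hρ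
  have hterm2 : 0 ≤ 16 * (T / ρ) * (∑ u, if G.Adj v u then 1 / (G.degree u : ℝ) else 0) := by
    have : 0 ≤ (∑ u, if G.Adj v u then 1 / (G.degree u : ℝ) else 0) :=
      Finset.sum_nonneg fun u _ => by split_ifs <;> positivity
    positivity
  have hterm3 : 0 ≤ 4 * T * (if ∃ u, ρ < G.dist v u then
        (G.degree v : ℝ) / ∑ u ∈ Finset.univ.filter (fun u => G.dist v u ≤ ρ), (G.degree u : ℝ) else 0) := by
    have : 0 ≤ (if ∃ u, ρ < G.dist v u then
        (G.degree v : ℝ) / ∑ u ∈ Finset.univ.filter (fun u => G.dist v u ≤ ρ), (G.degree u : ℝ) else 0) := by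
      split_ifs <;> positivity
    positivity
  have hterm1 : (0:ℝ) ≤ 16 * (ρ:ℝ)^2 := by positivity
  rcases hh.eq_or_lt with h0 | hpos
  · rw [← h0]; linarith
  have hdv : (0:ℝ) < G.degree v := by exact_mod_cast hd v
  have hMpos : 0 < f v := by
    rcases hM.eq_or_lt with h0 | h1
    · rw [← h0] at hfv; nlinarith
    · exact h1
  -- volume bound
  have hvol : ∀ S : Finset V, (∀ u ∈ S, f v / 2 ≤ f u) →
      h * ∑ u ∈ S, (G.degree u : ℝ) ≤ 4 * T * G.degree v := by
    intro S hS
    have h1 : (f v)^2 / 4 * ∑ u ∈ S, (G.degree u : ℝ) ≤ T * h := by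
      refine le_trans ?_ hnorm
      rw [Finset.mul_sum]
      refine le_trans (Finset.sum_le_sum fun u hu => ?_)
        (Finset.sum_le_sum_of_subset_of_nonneg (Finset.subset_univ S) fun u _ _ => by positivity)
      have := hS u hu
      have h3 : (f v)^2/4 ≤ (f u)^2 := by nlinarith
      rw [mul_comm]
      exact mul_le_mul_of_nonneg_left h3 (by positivity)
    have h2 : h^2 * ∑ u ∈ S, (G.degree u : ℝ) ≤ 4 * T * h * G.degree v := by
      rw [← hfv]; nlinarith
    have h3 : h * (h * ∑ u ∈ S, (G.degree u : ℝ)) ≤ h * (4 * T * G.degree v) := by linarith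
    exact le_of_mul_le_mul_left h3 hpos
  by_cases hdeg : G.degree v ≤ ρ
  · by_cases hex : ∃ u, G.dist v u ≤ ρ ∧ f u < f v / 2
    · obtain ⟨u, hu, hfu⟩ := hex
      have hp := aux_path G hG f v u
      rw [hen] at hp
      have h1 : (f v)^2/4 ≤ (f u - f v)^2 := by nlinarith
      have hu' : (G.dist v u : ℝ) ≤ ρ := by exact_mod_cast hu
      have hdeg' : (G.degree v : ℝ) ≤ ρ := by exact_mod_cast hdeg
      have h2 : (f v)^2 ≤ 16 * ρ * h := by nlinarith
      have h3 : h * h ≤ h * (16 * ρ^2) := by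
        calc h * h = (f v)^2 * G.degree v := by rw [hfv]; ring
          _ ≤ (16 * ρ * h) * ρ := by gcongr
          _ = _ := by ring
      have := le_of_mul_le_mul_left h3 hpos
      linarith
    · push Not at hex
      have hfar : ∃ u, ρ < G.dist v u := by
        by_contra! hcon
        have : 0 < ∑ u, (G.degree u : ℝ) * f u := by
          refine Finset.sum_pos (fun u _ => ?_) ⟨v, Finset.mem_univ v⟩
          have h1 := hex u (hcon u)
          have h2 : (0:ℝ) < G.degree u := by exact_mod_cast hd u
          have : 0 < f u := by linarith
          positivity
        linarith
      rw [if_pos hfar]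
      have hv := hvol (Finset.univ.filter (fun u => G.dist v u ≤ ρ)) (by
        intro u hu
        simp only [Finset.mem_filter, Finset.mem_univ, true_and] at hu
        exact hex u hu)
      have hvp : 0 < ∑ u ∈ Finset.univ.filter (fun u => G.dist v u ≤ ρ), (G.degree u : ℝ) := by
        refine Finset.sum_pos (fun u _ => by exact_mod_cast hd u) ⟨v, by simp⟩
      have : h ≤ 4 * T * ((G.degree v : ℝ) / ∑ u ∈ Finset.univ.filter (fun u => G.dist v u ≤ ρ), (G.degree u : ℝ)) := by
        rw [← mul_div_assoc, le_div_iff₀ hvp]; exact hv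
      linarith
  · push Not at hdeg
    set A := (G.neighborFinset v).filter (fun u => f v / 2 ≤ f u) with hA
    set B := (G.neighborFinset v).filter (fun u => ¬ f v / 2 ≤ f u) with hB
    have hAB : (A.card : ℝ) + B.card = G.degree v := by
      rw [← SimpleGraph.card_neighborFinset_eq_degree]
      exact_mod_cast Finset.card_filter_add_card_filter_not (s := G.neighborFinset v) (fun u => f v / 2 ≤ f u)
    by_cases hhalf : (G.degree v : ℝ) / 2 ≤ B.card
    · have h1 : (B.card : ℝ) * ((f v)^2/4) ≤ 4 * h := by
        rw [← hen]
        unfold auxEn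
        have h2 : ∑ w, (if G.Adj v w then (f v - f w)^2 else 0) ≤ ∑ u, ∑ w, if G.Adj u w then (f u - f w)^2 else 0 :=
          Finset.single_le_sum (f := fun u => ∑ w, if G.Adj u w then (f u - f w)^2 else 0)
            (fun u _ => Finset.sum_nonneg fun w _ => by split_ifs <;> positivity) (Finset.mem_univ v)
        refine le_trans ?_ h2
        rw [← nsmul_eq_mul, ← Finset.sum_const]
        refine le_trans (Finset.sum_le_sum fun u hu => ?_)
          (Finset.sum_le_sum_of_subset_of_nonneg (Finset.subset_univ B) fun u _ _ => by
            split_ifs <;> positivity)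
        simp only [hB, Finset.mem_filter, SimpleGraph.mem_neighborFinset, not_le] at hu
        rw [if_pos hu.1]
        nlinarith
      have h2 : h * h ≤ h * 32 := by
        have : (G.degree v : ℝ) / 2 * ((f v)^2/4) ≤ 4 * h :=
          (mul_le_mul_of_nonneg_right hhalf (by positivity)).trans h1
        nlinarith
      have := le_of_mul_le_mul_left h2 hpos
      linarith
    · push Not at hhalf
      have hAc : (G.degree v : ℝ) / 2 ≤ A.card := by linarith
      have hv := hvol A (by
        intro u hu
        simp only [hA, Finset.mem_filter] at hu
        exact hu.2)
      have hcs : (A.card : ℝ)^2 ≤ (∑ u ∈ A, (G.degree u : ℝ)) * (∑ u ∈ A, 1 / (G.degree u : ℝ)) := by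
        have := Finset.sum_sq_le_sum_mul_sum_of_sq_le_mul A (r := fun _ => (1:ℝ))
          (f := fun u => (G.degree u : ℝ)) (g := fun u => 1 / (G.degree u : ℝ))
          (fun u _ => by positivity) (fun u _ => by positivity) (fun u _ => by
            have : (0:ℝ) < G.degree u := by exact_mod_cast hd u
            rw [mul_one_div_cancel this.ne']; norm_num)
        simpa using this
      have hle : ∑ u ∈ A, 1 / (G.degree u : ℝ) ≤ ∑ u, if G.Adj v u then 1 / (G.degree u : ℝ) else 0 := by
        refine le_trans (Finset.sum_le_sum fun u hu => ?_)
          (Finset.sum_le_sum_of_subset_of_nonneg (Finset.subset_univ A) fun u _ _ => by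
            split_ifs <;> positivity)
        simp only [hA, Finset.mem_filter, SimpleGraph.mem_neighborFinset] at hu
        rw [if_pos hu.1]
      set R := ∑ u, if G.Adj v u then 1 / (G.degree u : ℝ) else 0 with hR
      set Q := ∑ u ∈ A, 1 / (G.degree u : ℝ) with hQ
      set vol := ∑ u ∈ A, (G.degree u : ℝ) with hvoldef
      have hQ0 : 0 ≤ Q := Finset.sum_nonneg fun u _ => by positivity
      have h1 : h * (G.degree v : ℝ)^2 ≤ 16 * T * G.degree v * R := by
        calc h * (G.degree v : ℝ)^2 = 4 * h * ((G.degree v : ℝ)/2)^2 := by ring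
          _ ≤ 4 * h * (A.card : ℝ)^2 := by gcongr
          _ ≤ 4 * h * (vol * Q) := by gcongr
          _ = 4 * (h * vol) * Q := by ring
          _ ≤ 4 * (4 * T * G.degree v) * Q := by gcongr
          _ ≤ 4 * (4 * T * G.degree v) * R := by gcongr
          _ = _ := by ring
      have h2 : h * G.degree v ≤ 16 * T * R := by
        have : (G.degree v : ℝ) * (h * G.degree v) ≤ G.degree v * (16 * T * R) := by linarith
        exact le_of_mul_le_mul_left this hdv
      have hdeg' : (ρ : ℝ) ≤ G.degree v := by exact_mod_cast hdeg.le
      have h3 : h ≤ 16 * (T / ρ) * R := by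
        rw [show 16 * (T / ρ) * R = (16 * T * R) / ρ by ring, le_div_iff₀ (by linarith)]
        nlinarith
      linarith

set_option maxHeartbeats 1000000 in
lemma aux_core (G : SimpleGraph V) (hG : G.Connected) (T : ℝ) (hT : 1 ≤ T)
    (hd : ∀ u, 0 < G.degree u) (h : V → ℝ) (hh : ∀ v, 0 ≤ h v) (f : V → V → ℝ) (hM : ∀ v, 0 ≤ f v v)
    (hfv : ∀ v, (f v v)^2 * G.degree v = h v ^2)
    (hmean : ∀ v, ∑ u, (G.degree u : ℝ) * f v u = 0) (hen : ∀ v, auxEn G (f v) = 4 * h v)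
    (hnorm : ∀ v, ∑ u, (G.degree u : ℝ) * (f v u)^2 ≤ T * h v) :
    ∑ v, h v ≤ 320 * (Fintype.card V : ℝ) * T ^ ((2:ℝ)/3) := by
  set y := T ^ ((1:ℝ)/3) with hy
  have hy1 : 1 ≤ y := Real.one_le_rpow hT (by norm_num)
  have hy3 : y ^ 3 = T := by
    rw [hy, ← Real.rpow_natCast, ← Real.rpow_mul (by linarith)]; norm_num
  have hy2 : y ^ 2 = T ^ ((2:ℝ)/3) := by
    rw [hy, ← Real.rpow_natCast, ← Real.rpow_mul (by linarith)]; norm_num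
  set ρ := ⌈y⌉₊ with hρdef
  have hρy : y ≤ ρ := Nat.le_ceil y
  have hρ1 : (1:ℝ) ≤ ρ := by linarith
  have hρ : 1 ≤ ρ := by exact_mod_cast hρ1
  have hρ2 : (ρ:ℝ) ≤ 2 * y := by
    have := Nat.ceil_lt_add_one (a := y) (by linarith)
    linarith
  have hTρ : T / ρ ≤ (ρ:ℝ)^2 := by
    rw [div_le_iff₀ (by linarith), ← hy3, ← pow_succ]
    exact pow_le_pow_left₀ (by linarith) hρy 3
  have hsum : ∑ v, h v ≤ ∑ v, (16 * (ρ:ℝ)^2 + 32 + 16 * (T / ρ) * (∑ u, if G.Adj v u then 1 / (G.degree u : ℝ) else 0) +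
      4 * T * (if ∃ u, ρ < G.dist v u then
        (G.degree v : ℝ) / ∑ u ∈ Finset.univ.filter (fun u => G.dist v u ≤ ρ), (G.degree u : ℝ) else 0)) :=
    Finset.sum_le_sum fun v _ => aux_pointwise G hG ρ hρ T hT v (h v) (hh v) hd (f v) (hM v) (hfv v)
      (hmean v) (hen v) (hnorm v)
  have hinv : ∑ v, ∑ u, (if G.Adj v u then 1 / (G.degree u : ℝ) else 0) = Fintype.card V := by
    rw [Finset.sum_comm]
    have : ∀ u, ∑ v, (if G.Adj v u then 1 / (G.degree u : ℝ) else 0) = 1 := by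
      intro u
      rw [← Finset.sum_filter, Finset.sum_const]
      have : (Finset.univ.filter fun v => G.Adj v u) = G.neighborFinset u := by
        ext v
        rw [Finset.mem_filter, SimpleGraph.mem_neighborFinset, SimpleGraph.adj_comm]
        simp
      rw [this, SimpleGraph.card_neighborFinset_eq_degree, nsmul_eq_mul]
      have : (0:ℝ) < G.degree u := by exact_mod_cast hd u
      field_simp
    rw [Finset.sum_congr rfl fun u _ => this u]
    simp
  have hcov := aux_cover G hG ρ hρ
  rw [Finset.sum_filter] at hcov
  rw [Finset.sum_add_distrib, Finset.sum_add_distrib, ← Finset.mul_sum, ← Finset.mul_sum, hinv] at hsum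
  simp only [Finset.sum_const, Finset.card_univ, nsmul_eq_mul] at hsum
  set n := (Fintype.card V : ℝ) with hn
  have hn0 : 0 ≤ n := by positivity
  have h4 : 4 * T * (4 * n / ρ) ≤ 16 * n * (ρ:ℝ)^2 := by
    rw [show 4 * T * (4 * n / ρ) = 16 * n * (T/ρ) by ring]
    gcongr
  have h5 : 16 * (T/ρ) * n ≤ 16 * (ρ:ℝ)^2 * n := by gcongr
  have h6 := mul_le_mul_of_nonneg_left hcov (show 0 ≤ 4 * T by linarith)
  rw [← hy2]
  have h7 : (ρ:ℝ)^2 ≤ 4 * y^2 := by nlinarith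
  have h8 : (1:ℝ) ≤ (ρ:ℝ)^2 := by nlinarith
  have h9 : n * 1 ≤ n * (ρ:ℝ)^2 := by gcongr
  have h10 : n * (ρ:ℝ)^2 ≤ n * (4 * y^2) := by gcongr
  linarith

end Core

section Spec
variable {V : Type} [Fintype V]

noncomputable def auxS (G : SimpleGraph V) (u : V) : ℝ := Real.sqrt (G.degree u)

noncomputable def auxA (G : SimpleGraph V) : Matrix V V ℝ :=
  Matrix.of fun u v => if u = v then 1 / 2 else if G.Adj u v then 1 / (2 * auxS G u * auxS G v) else 0

lemma auxA_apply (G : SimpleGraph V) (u v : V) : auxA G u v =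
    if u = v then 1 / 2 else if G.Adj u v then 1 / (2 * auxS G u * auxS G v) else 0 := rfl

lemma aux_deg_pos [Nontrivial V] (G : SimpleGraph V) (hG : G.Connected) (u : V) : 0 < G.degree u :=
  hG.preconnected.degree_pos_of_nontrivial u

lemma auxS_sq (G : SimpleGraph V) (u : V) : auxS G u * auxS G u = G.degree u :=
  Real.mul_self_sqrt (by positivity)

lemma auxS_pos [Nontrivial V] (G : SimpleGraph V) (hG : G.Connected) (u : V) : 0 < auxS G u :=
  Real.sqrt_pos.2 (by exact_mod_cast aux_deg_pos G hG u)

lemma auxA_symm (G : SimpleGraph V) (u v : V) : auxA G u v = auxA G v u := by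
  simp only [auxA_apply, eq_comm (a := u), G.adj_comm u v]
  congr 2
  ring

lemma auxA_herm (G : SimpleGraph V) : (auxA G).IsHermitian := by
  ext u v
  rw [Matrix.conjTranspose_apply, star_trivial]
  exact auxA_symm G v u

lemma auxP_eq [Nontrivial V] (G : SimpleGraph V) (hG : G.Connected) (u v : V) :
    lazyP G u v = auxA G u v * auxS G v / auxS G u := by
  have hu := auxS_pos G hG u
  have hv := auxS_pos G hG v
  rw [auxA_apply]
  unfold lazyP
  by_cases h : u = v
  · subst h
    simp [hu.ne']
  · simp only [h, if_false]
    by_cases h2 : G.Adj u v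
    · simp only [h2, if_true]
      rw [← auxS_sq]
      field_simp
    · simp [h2]

lemma auxP_pow_eq [Nontrivial V] (G : SimpleGraph V) (hG : G.Connected) (i : ℕ) : ∀ (u v : V),
    (lazyP G ^ i) u v = (auxA G ^ i) u v * auxS G v / auxS G u := by
  induction i with
  | zero =>
    intro u v
    have hu := auxS_pos G hG u
    rw [pow_zero, pow_zero, Matrix.one_apply]
    by_cases h : u = v
    · subst h
      simp [hu.ne']
    · simp [h]
  | succ i ih =>
    intro u v
    rw [pow_succ, pow_succ, Matrix.mul_apply, Matrix.mul_apply, Finset.sum_mul, Finset.sum_div]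
    refine Finset.sum_congr rfl fun w _ => ?_
    have hw := auxS_pos G hG w
    have hu := auxS_pos G hG u
    rw [ih, auxP_eq G hG]
    field_simp

structure AuxSpec (G : SimpleGraph V) (lam : V → ℝ) (φ : V → V → ℝ) : Prop where
  on : ∀ k l, ∑ u, φ k u * φ l u = if k = l then 1 else 0
  comp : ∀ u v, ∑ k, φ k u * φ k v = if u = v then 1 else 0
  eig : ∀ k u, ∑ v, auxA G u v * φ k v = lam k * φ k u

lemma aux_exists_spec (G : SimpleGraph V) : ∃ lam φ, AuxSpec G lam φ := by
  set hA := auxA_herm G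
  set U : Matrix V V ℝ := (hA.eigenvectorUnitary : Matrix V V ℝ) with hU
  have h1 : star U * U = 1 := Unitary.coe_star_mul_self hA.eigenvectorUnitary
  have h2 : U * star U = 1 := Unitary.coe_mul_star_self hA.eigenvectorUnitary
  refine ⟨hA.eigenvalues, fun k u => U u k, ⟨?_, ?_, ?_⟩⟩
  · intro k l
    have := congrFun (congrFun h1 k) l
    rw [Matrix.mul_apply, Matrix.one_apply] at this
    rw [← this]
    refine Finset.sum_congr rfl fun u _ => ?_
    rw [Matrix.star_apply, star_trivial]
  · intro k l
    have := congrFun (congrFun h2 k) l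
    rw [Matrix.mul_apply, Matrix.one_apply] at this
    rw [← this]
    refine Finset.sum_congr rfl fun u _ => ?_
    rw [Matrix.star_apply, star_trivial]
  · intro k u
    have := congrFun (hA.mulVec_eigenvectorBasis k) u
    rw [Matrix.mulVec, dotProduct] at this
    simpa [hU, Matrix.IsHermitian.eigenvectorUnitary_apply] using this

variable {G : SimpleGraph V} {lam : V → ℝ} {φ : V → V → ℝ}

lemma AuxSpec.parseval (h : AuxSpec G lam φ) (a b : V → ℝ) :
    ∑ u, (∑ k, a k * φ k u) * (∑ l, b l * φ l u) = ∑ k, a k * b k := by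
  simp only [Finset.sum_mul_sum]
  rw [Finset.sum_comm]
  refine Finset.sum_congr rfl fun k _ => ?_
  rw [Finset.sum_comm]
  calc _ = ∑ l, a k * b l * ∑ u, φ k u * φ l u := by
        refine Finset.sum_congr rfl fun l _ => ?_
        rw [Finset.mul_sum]
        exact Finset.sum_congr rfl fun u _ => by ring
    _ = _ := by simp [h.on]

lemma AuxSpec.expand (h : AuxSpec G lam φ) (F : V → ℝ) (u : V) :
    F u = ∑ k, (∑ v, φ k v * F v) * φ k u := by
  simp only [Finset.sum_mul]
  rw [Finset.sum_comm]
  calc F u = ∑ v, (∑ k, φ k v * φ k u) * F v := by simp [h.comp]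
    _ = _ := by
      refine Finset.sum_congr rfl fun v _ => ?_
      rw [Finset.sum_mul]
      exact Finset.sum_congr rfl fun u _ => by ring

lemma AuxSpec.exists_ne (h : AuxSpec G lam φ) (F : V → ℝ) (hF : F ≠ 0) : ∃ k, ∑ v, φ k v * F v ≠ 0 := by
  by_contra! hcon
  apply hF
  funext u
  rw [h.expand F u]
  simp [hcon]

lemma AuxSpec.eigA (h : AuxSpec G lam φ) (a : V → ℝ) (u : V) :
    ∑ v, auxA G u v * (∑ k, a k * φ k v) = ∑ k, a k * lam k * φ k u := by
  simp only [Finset.mul_sum]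
  rw [Finset.sum_comm]
  refine Finset.sum_congr rfl fun k _ => ?_
  rw [mul_assoc, ← h.eig k u, Finset.mul_sum]
  exact Finset.sum_congr rfl fun v _ => by ring

lemma AuxSpec.pow_eig (h : AuxSpec G lam φ) (i : ℕ) (k : V) : ∀ u, ∑ v, (auxA G ^ i) u v * φ k v = lam k ^ i * φ k u := by
  induction i with
  | zero => intro u; simp [Matrix.one_apply]
  | succ i ih =>
    intro u
    rw [pow_succ]
    simp only [Matrix.mul_apply, Finset.sum_mul]
    rw [Finset.sum_comm]
    calc _ = ∑ w, (auxA G ^ i) u w * ∑ v, auxA G w v * φ k v := by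
          refine Finset.sum_congr rfl fun w _ => ?_
          rw [Finset.mul_sum]
          exact Finset.sum_congr rfl fun v _ => by ring
      _ = (∑ w, (auxA G ^ i) u w * φ k w) * lam k := by
          rw [Finset.sum_mul]
          refine Finset.sum_congr rfl fun w _ => ?_
          rw [h.eig]; ring
      _ = _ := by rw [ih]; ring

lemma AuxSpec.pow_apply (h : AuxSpec G lam φ) (i : ℕ) (u v : V) :
    (auxA G ^ i) u v = ∑ k, lam k ^ i * φ k u * φ k v := by
  calc (auxA G ^ i) u v = ∑ w, (auxA G ^ i) u w * ∑ k, φ k w * φ k v := by simp [h.comp]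
    _ = ∑ k, (∑ w, (auxA G ^ i) u w * φ k w) * φ k v := by
        simp only [Finset.mul_sum, Finset.sum_mul]
        rw [Finset.sum_comm]
        exact Finset.sum_congr rfl fun k _ => Finset.sum_congr rfl fun v _ => by ring
    _ = _ := by simp only [h.pow_eig]

/-- self-adjointness -/
lemma AuxSpec.inner_eig (h : AuxSpec G lam φ) (k : V) (F : V → ℝ) (r : ℝ)
    (hF : ∀ u, ∑ v, auxA G u v * F v = r * F u) : (lam k - r) * ∑ v, φ k v * F v = 0 := by
  have h1 : lam k * ∑ v, φ k v * F v = ∑ v, ∑ w, auxA G v w * φ k w * F v := by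
    rw [Finset.mul_sum]
    refine Finset.sum_congr rfl fun v _ => ?_
    rw [← mul_assoc, ← h.eig k v, Finset.sum_mul]
  have h2 : r * ∑ v, φ k v * F v = ∑ v, ∑ w, auxA G v w * φ k v * F w := by
    rw [Finset.mul_sum]
    refine Finset.sum_congr rfl fun v _ => ?_
    rw [show r * (φ k v * F v) = φ k v * (r * F v) by ring, ← hF v, Finset.mul_sum]
    exact Finset.sum_congr rfl fun w _ => by ring
  rw [sub_mul, h1, h2, sub_eq_zero, Finset.sum_comm]
  refine Finset.sum_congr rfl fun v _ => Finset.sum_congr rfl fun w _ => ?_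
  rw [auxA_symm]

lemma aux_nbr_sum (G : SimpleGraph V) (c : V → ℝ) (u : V) :
    ∑ v, (if G.Adj u v then c u else 0) = G.degree u * c u := by
  rw [← Finset.sum_filter, Finset.sum_const, nsmul_eq_mul]
  have : (Finset.univ.filter fun v => G.Adj u v) = G.neighborFinset u := by
    ext v
    rw [Finset.mem_filter, SimpleGraph.mem_neighborFinset]
    simp
  rw [this, SimpleGraph.card_neighborFinset_eq_degree]

lemma auxA_mul [Nontrivial V] (hG : G.Connected) (f : V → ℝ) (u : V) :
    auxS G u * ∑ v, auxA G u v * (auxS G v * f v) =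
      1/2 * (G.degree u * f u) + 1/2 * ∑ v, if G.Adj u v then f v else 0 := by
  have e : ∀ v, auxS G u * (auxA G u v * (auxS G v * f v)) =
      (if u = v then 1/2 * (G.degree v * f v) else 0) + 1/2 * (if G.Adj u v then f v else 0) := by
    intro v
    have hu := auxS_pos G hG u
    have hv := auxS_pos G hG v
    rw [auxA_apply]
    by_cases h : u = v
    · subst h
      simp only [if_true, SimpleGraph.irrefl, if_false]
      rw [← auxS_sq]; ring
    · simp only [h, if_false]
      by_cases h2 : G.Adj u v
      · simp only [h2, if_true]
        field_simp
        ring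
      · simp [h2]
  rw [Finset.mul_sum, Finset.sum_congr rfl fun v _ => e v, Finset.sum_add_distrib, ← Finset.mul_sum]
  simp

lemma aux_quad [Nontrivial V] (hG : G.Connected) (f : V → ℝ) :
    ∑ u, (auxS G u * f u) * ∑ v, auxA G u v * (auxS G v * f v) =
      1/2 * (∑ u, G.degree u * f u ^ 2) + 1/2 * ∑ u, ∑ v, if G.Adj u v then f u * f v else 0 := by
  rw [Finset.mul_sum, Finset.mul_sum, ← Finset.sum_add_distrib]
  refine Finset.sum_congr rfl fun u _ => ?_
  rw [show (auxS G u * f u) * ∑ v, auxA G u v * (auxS G v * f v) =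
    f u * (auxS G u * ∑ v, auxA G u v * (auxS G v * f v)) by ring, auxA_mul hG]
  have : ∑ v, (if G.Adj u v then f u * f v else 0) = f u * ∑ v, if G.Adj u v then f v else 0 := by
    rw [Finset.mul_sum]
    refine Finset.sum_congr rfl fun v _ => ?_
    split_ifs <;> simp
  rw [this]; ring

lemma aux_adj_sq (f : V → ℝ) (c : ℝ) : ∑ u, ∑ v, (if G.Adj u v then (f u ^ 2 + f v ^ 2 + c * (f u * f v)) else 0) =
    2 * (∑ u, G.degree u * f u ^ 2) + c * ∑ u, ∑ v, if G.Adj u v then f u * f v else 0 := by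
  have h1 : ∑ u, ∑ v, (if G.Adj u v then f u ^ 2 else 0) = ∑ u, G.degree u * f u ^ 2 :=
    Finset.sum_congr rfl fun u _ => aux_nbr_sum G (fun u => f u ^ 2) u
  have h2 : ∑ u, ∑ v, (if G.Adj u v then f v ^ 2 else 0) = ∑ u, G.degree u * f u ^ 2 := by
    rw [← h1, Finset.sum_comm]
    refine Finset.sum_congr rfl fun v _ => Finset.sum_congr rfl fun w _ => ?_
    simp only [G.adj_comm w v]
  rw [two_mul]
  conv_rhs => rw [← h1]
  rw [h1]
  conv_rhs => enter [1]; rw [← h1]; enter [2]; rw [h1, ← h2]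
  simp only [Finset.mul_sum, ← Finset.sum_add_distrib]
  refine Finset.sum_congr rfl fun v _ => Finset.sum_congr rfl fun w _ => ?_
  split_ifs <;> ring

lemma aux_energy [Nontrivial V] (hG : G.Connected) (f : V → ℝ) :
    auxEn G f = 4 * (∑ u, (auxS G u * f u) * (auxS G u * f u) -
      ∑ u, (auxS G u * f u) * ∑ v, auxA G u v * (auxS G v * f v)) := by
  rw [aux_quad hG]
  have h1 : ∑ u, (auxS G u * f u) * (auxS G u * f u) = ∑ u, G.degree u * f u ^ 2 :=
    Finset.sum_congr rfl fun u _ => by rw [← auxS_sq]; ring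
  have h2 := aux_adj_sq (G := G) f (-2)
  have h3 : auxEn G f = ∑ u, ∑ v, (if G.Adj u v then (f u ^ 2 + f v ^ 2 + (-2) * (f u * f v)) else 0) := by
    unfold auxEn
    refine Finset.sum_congr rfl fun v _ => Finset.sum_congr rfl fun w _ => ?_
    split_ifs <;> ring
  rw [h1, h3, h2]; ring

lemma aux_quad_nonneg [Nontrivial V] (hG : G.Connected) (f : V → ℝ) :
    0 ≤ ∑ u, (auxS G u * f u) * ∑ v, auxA G u v * (auxS G v * f v) := by
  rw [aux_quad hG]
  have h2 := aux_adj_sq (G := G) f 2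
  have : 0 ≤ ∑ u, ∑ v, (if G.Adj u v then (f u ^ 2 + f v ^ 2 + 2 * (f u * f v)) else 0) := by
    refine Finset.sum_nonneg fun u _ => Finset.sum_nonneg fun v _ => ?_
    split_ifs
    · nlinarith [sq_nonneg (f u + f v)]
    · exact le_rfl
  linarith

lemma aux_en_nonneg (f : V → ℝ) : 0 ≤ auxEn G f :=
  Finset.sum_nonneg fun u _ => Finset.sum_nonneg fun v _ => by split_ifs <;> positivity

lemma AuxSpec.en_phi [Nontrivial V] (h : AuxSpec G lam φ) (hG : G.Connected) (k : V) :
    auxEn G (fun u => φ k u / auxS G u) = 4 * (1 - lam k) ∧ 0 ≤ lam k := by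
  have e : ∀ u, auxS G u * (φ k u / auxS G u) = φ k u := fun u => by
    have := auxS_pos G hG u
    field_simp
  have h1 : ∑ u, φ k u * ∑ v, auxA G u v * φ k v = lam k := by
    simp only [h.eig]
    calc _ = lam k * ∑ u, φ k u * φ k u := by
          rw [Finset.mul_sum]; exact Finset.sum_congr rfl fun u _ => by ring
      _ = _ := by simp [h.on]
  constructor
  · rw [aux_energy hG]
    simp only [e]
    rw [h1, h.on]; simp
  · have := aux_quad_nonneg hG (fun u => φ k u / auxS G u)
    simp only [e] at this
    rwa [h1] at this

lemma AuxSpec.lam_nonneg [Nontrivial V] (h : AuxSpec G lam φ) (hG : G.Connected) (k : V) : 0 ≤ lam k :=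
  (h.en_phi hG k).2

lemma AuxSpec.lam_le [Nontrivial V] (h : AuxSpec G lam φ) (hG : G.Connected) (k : V) : lam k ≤ 1 := by
  have h1 := (h.en_phi hG k).1
  have h2 := aux_en_nonneg (G := G) (fun u => φ k u / auxS G u)
  linarith

lemma AuxSpec.const [Nontrivial V] (h : AuxSpec G lam φ) (hG : G.Connected) (k : V) (hk : lam k = 1) :
    ∃ c : ℝ, ∀ u, φ k u = c * auxS G u := by
  obtain ⟨v⟩ : Nonempty V := inferInstance
  refine ⟨φ k v / auxS G v, fun u => ?_⟩
  have h1 := (h.en_phi hG k).1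
  rw [hk] at h1
  have h2 := aux_path G hG (fun u => φ k u / auxS G u) v u
  rw [h1] at h2
  have h3 : φ k u / auxS G u - φ k v / auxS G v = 0 := by
    have : (φ k u / auxS G u - φ k v / auxS G v)^2 ≤ 0 := by simpa using h2
    exact pow_eq_zero_iff (two_ne_zero) |>.1 (le_antisymm this (sq_nonneg _))
  rw [← sub_eq_zero.1 h3]
  have := auxS_pos G hG u
  field_simp

lemma aux_s_eig [Nontrivial V] (hG : G.Connected) (u : V) : ∑ v, auxA G u v * auxS G v = 1 * auxS G u := by
  have h := auxA_mul hG (fun _ => 1) u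
  rw [aux_nbr_sum G (fun _ => 1) u] at h
  have hu := auxS_pos G hG u
  have h2 : auxS G u * ∑ v, auxA G u v * auxS G v = auxS G u * (1 * auxS G u) := by
    simp only [mul_one] at h
    rw [h, one_mul, auxS_sq]; ring
  exact mul_left_cancel₀ hu.ne' h2

lemma AuxSpec.orth [Nontrivial V] (h : AuxSpec G lam φ) (hG : G.Connected) (k : V) (hk : lam k ≠ 1) :
    ∑ v, φ k v * auxS G v = 0 := by
  have := h.inner_eig k (auxS G) 1 (aux_s_eig hG)
  rcases mul_eq_zero.1 this with h1 | h1
  · exact absurd (by linarith) hk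
  · exact h1

lemma aux_sum_deg (G : SimpleGraph V) : ∑ u, (G.degree u : ℝ) = 2 * numEdges G := by
  have := G.sum_degrees_eq_twice_card_edges
  unfold numEdges
  exact_mod_cast this

lemma AuxSpec.exists_top [Nontrivial V] (h : AuxSpec G lam φ) (hG : G.Connected) :
    ∃ k0, (∀ k, lam k = 1 ↔ k = k0) ∧ ∃ c : ℝ, (∀ u, φ k0 u = c * auxS G u) ∧ c * c * (2 * numEdges G) = 1 := by
  have hs : auxS G ≠ 0 := by
    obtain ⟨v⟩ : Nonempty V := inferInstance
    intro h0
    have := auxS_pos G hG v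
    rw [h0] at this
    simp at this
  obtain ⟨k0, hk0⟩ := h.exists_ne (auxS G) hs
  have hl : lam k0 = 1 := by
    by_contra hne
    exact hk0 (h.orth hG k0 hne)
  obtain ⟨c, hc⟩ := h.const hG k0 hl
  have hnorm : c * c * (2 * numEdges G) = 1 := by
    have := h.on k0 k0
    simp only [hc, if_true] at this
    rw [← this, ← aux_sum_deg, Finset.mul_sum]
    exact Finset.sum_congr rfl fun u _ => by rw [← auxS_sq]; ring
  refine ⟨k0, fun k => ⟨fun hk => ?_, fun hk => hk ▸ hl⟩, c, hc, hnorm⟩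
  by_contra hne
  obtain ⟨c', hc'⟩ := h.const hG k hk
  have h1 := h.on k k0
  have h2 := h.on k k
  simp only [hc, hc', hne, if_false, if_true] at h1 h2
  have h3 : c' * c * (2 * numEdges G) = 0 := by
    rw [← h1, ← aux_sum_deg, Finset.mul_sum]
    exact Finset.sum_congr rfl fun u _ => by rw [← auxS_sq]; ring
  have h4 : c' * c' * (2 * numEdges G) = 1 := by
    rw [← h2, ← aux_sum_deg, Finset.mul_sum]
    exact Finset.sum_congr rfl fun u _ => by rw [← auxS_sq]; ring
  have h5 : (c' * c * (2 * numEdges G))^2 = (c' * c' * (2 * numEdges G)) * (c * c * (2 * numEdges G)) := by ring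
  rw [h3, h4, hnorm] at h5
  norm_num at h5

end Spec

section Final
variable {V : Type} [Fintype V] [Nontrivial V] {G : SimpleGraph V} {lam : V → ℝ} {φ : V → V → ℝ}

lemma AuxSpec.second (h : AuxSpec G lam φ) (hG : G.Connected) :
    secondEig (lazyP G) < 1 ∧ ∀ k, lam k ≠ 1 → lam k ≤ secondEig (lazyP G) := by
  set R := {r : ℝ | r ≠ 1 ∧ ∃ f : V → ℝ, f ≠ 0 ∧ (lazyP G).mulVec f = r • f} with hR
  have hsub : ∀ r ∈ R, ∃ k, lam k = r := by
    rintro r ⟨hr, f, hf, hPf⟩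
    have hF : ∀ u, ∑ v, auxA G u v * (auxS G v * f v) = r * (auxS G u * f u) := by
      intro u
      have hu := auxS_pos G hG u
      have h1 := congrFun hPf u
      rw [Matrix.mulVec, dotProduct] at h1
      simp only [Pi.smul_apply, smul_eq_mul, auxP_eq G hG] at h1
      rw [show r * (auxS G u * f u) = auxS G u * (r * f u) by ring, ← h1, Finset.mul_sum]
      refine Finset.sum_congr rfl fun v _ => ?_
      field_simp
    have hne : (fun v => auxS G v * f v) ≠ 0 := by
      intro h0
      apply hf
      funext u
      have h1 := congrFun h0 u
      simp only [Pi.zero_apply, mul_eq_zero] at h1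
      exact h1.resolve_left (auxS_pos G hG u).ne'
    obtain ⟨k, hk⟩ := h.exists_ne _ hne
    refine ⟨k, ?_⟩
    have := h.inner_eig k (fun v => auxS G v * f v) r hF
    rcases mul_eq_zero.1 this with h1 | h1
    · linarith
    · exact absurd h1 hk
  have hfin : R.Finite := (Set.finite_range lam).subset fun r hr => by
    obtain ⟨k, hk⟩ := hsub r hr
    exact ⟨k, hk⟩
  have hmem : ∀ k, lam k ≠ 1 → lam k ∈ R := by
    intro k hk
    refine ⟨hk, fun u => φ k u / auxS G u, ?_, ?_⟩
    · intro h0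
      have h1 := h.on k k
      have h2 : ∀ u, φ k u = 0 := by
        intro u
        have := congrFun h0 u
        simp only [Pi.zero_apply, div_eq_zero_iff] at this
        exact this.resolve_right (auxS_pos G hG u).ne'
      simp [h2] at h1
    · funext u
      rw [Matrix.mulVec, dotProduct]
      simp only [Pi.smul_apply, smul_eq_mul, auxP_eq G hG]
      rw [← mul_div_assoc, ← h.eig, Finset.sum_div]
      refine Finset.sum_congr rfl fun v _ => ?_
      have hu := auxS_pos G hG u
      have hv := auxS_pos G hG v
      field_simp
  have hdef : secondEig (lazyP G) = sSup R := rfl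
  constructor
  · rw [hdef]
    rcases R.eq_empty_or_nonempty with h0 | hne
    · rw [h0, Real.sSup_empty]; norm_num
    · have hm := hne.csSup_mem hfin
      obtain ⟨k, hk⟩ := hsub _ hm
      have := h.lam_le hG k
      exact lt_of_le_of_ne (hk ▸ this) hm.1
  · intro k hk
    exact le_csSup hfin.bddAbove (hmem k hk)

lemma AuxSpec.rel (h : AuxSpec G lam φ) (hG : G.Connected) :
    1 ≤ (relTime (lazyP G) : ℝ) ∧ ∀ k, lam k ≠ 1 → 1 / (1 - lam k) ≤ relTime (lazyP G) := by
  obtain ⟨h1, h2⟩ := h.second hG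
  have hpos : 0 < 1 / (1 - secondEig (lazyP G)) := by
    have : 0 < 1 - secondEig (lazyP G) := by linarith
    positivity
  constructor
  · exact_mod_cast Nat.ceil_pos.2 hpos
  · intro k hk
    refine le_trans ?_ (Nat.le_ceil _)
    apply one_div_le_one_div_of_le
    · linarith
    · have := h2 k hk; linarith

lemma AuxSpec.kemeny (h : AuxSpec G lam φ) (hG : G.Connected) :
    ∑ k, (if lam k = 1 then 0 else 1 / (1 - lam k)) ≤
      320 * (Fintype.card V : ℝ) * (relTime (lazyP G) : ℝ) ^ ((2:ℝ)/3) := by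
  obtain ⟨hT, hrel⟩ := h.rel hG
  set T : ℝ := ((relTime (lazyP G) : ℕ) : ℝ)
  let a : V → ℝ := fun k => if lam k = 1 then 0 else 1 / (1 - lam k)
  have ha0 : ∀ k, 0 ≤ a k := by
    intro k
    simp only [a]
    have := h.lam_le hG k
    split_ifs
    · exact le_rfl
    · exact div_nonneg zero_le_one (by linarith)
  have haT : ∀ k, a k ≤ T := by
    intro k
    simp only [a]
    split_ifs with hk
    · linarith
    · exact hrel k hk
  have ha1 : ∀ k, a k * a k - a k * (a k * lam k) = a k := by
    intro k
    simp only [a]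
    split_ifs with hk
    · simp
    · have : 1 - lam k ≠ 0 := fun h0 => hk (by linarith)
      field_simp
  have has : ∀ k, a k * ∑ v, φ k v * auxS G v = 0 := by
    intro k
    by_cases hk : lam k = 1
    · simp [a, hk]
    · rw [h.orth hG k hk, mul_zero]
  let H : V → ℝ := fun v => ∑ k, a k * φ k v ^ 2
  let F : V → V → ℝ := fun v u => ∑ k, (a k * φ k v) * φ k u
  have hFv : ∀ v, F v v = H v := fun v => Finset.sum_congr rfl fun k _ => by ring
  have hH0 : ∀ v, 0 ≤ H v := fun v => Finset.sum_nonneg fun k _ => mul_nonneg (ha0 k) (sq_nonneg _)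
  have e : ∀ v u, auxS G u * (F v u / auxS G u) = F v u := fun v u => by
    have := auxS_pos G hG u
    field_simp
  have hsumH : ∑ v, H v = ∑ k, a k := by
    simp only [H]
    rw [Finset.sum_comm]
    refine Finset.sum_congr rfl fun k _ => ?_
    rw [← Finset.mul_sum]
    have := h.on k k
    simp only [← sq, if_true] at this
    rw [this, mul_one]
  have hFF : ∀ v, ∑ u, F v u * F v u = ∑ k, (a k * a k) * φ k v ^ 2 := by
    intro v
    rw [h.parseval]
    exact Finset.sum_congr rfl fun k _ => by ring
  have hdeg : ∀ v u, (G.degree u : ℝ) * (F v u / auxS G u)^2 = F v u * F v u := by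
    intro v u
    have := auxS_pos G hG u
    rw [← auxS_sq]
    field_simp
  have key := aux_core G hG T hT (aux_deg_pos G hG) H hH0 (fun v u => F v u / auxS G u)
    (fun v => div_nonneg (by rw [hFv]; exact hH0 v) (auxS_pos G hG v).le)
    (fun v => by
      rw [mul_comm, hdeg, hFv]; ring)
    (fun v => by
      have : ∀ u, (G.degree u : ℝ) * (F v u / auxS G u) = F v u * auxS G u := by
        intro u
        have := auxS_pos G hG u
        rw [← auxS_sq]
        field_simp
      simp only [this, F, Finset.sum_mul]
      rw [Finset.sum_comm]
      refine Finset.sum_eq_zero fun k _ => ?_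
      calc _ = φ k v * (a k * ∑ u, φ k u * auxS G u) := by
            rw [Finset.mul_sum, Finset.mul_sum]
            exact Finset.sum_congr rfl fun u _ => by ring
        _ = 0 := by rw [has, mul_zero])
    (fun v => by
      rw [aux_energy hG]
      simp only [e]
      congr 1
      rw [hFF]
      have h1 : ∑ u, F v u * ∑ w, auxA G u w * F v w = ∑ k, (a k * (a k * lam k)) * φ k v ^ 2 := by
        simp only [F, h.eigA]
        rw [h.parseval]
        exact Finset.sum_congr rfl fun k _ => by ring
      rw [h1, ← Finset.sum_sub_distrib]
      refine Finset.sum_congr rfl fun k _ => ?_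
      rw [← sub_mul, ha1])
    (fun v => by
      simp only [hdeg]
      rw [hFF, Finset.mul_sum]
      refine Finset.sum_le_sum fun k _ => ?_
      rw [← mul_assoc]
      exact mul_le_mul_of_nonneg_right (mul_le_mul_of_nonneg_right (haT k) (ha0 k)) (sq_nonneg _))
  rw [hsumH] at key
  exact key

lemma AuxSpec.trace_bound (h : AuxSpec G lam φ) (hG : G.Connected) (t : ℕ) :
    ∑ u, ∑ v, green (lazyP G) t u v * green (lazyP G) t v u ≤
      320 * ((t:ℝ)^2 + (Fintype.card V : ℝ) * (relTime (lazyP G) : ℝ) ^ ((5:ℝ)/3)) := by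
  let γ : V → ℝ := fun k => ∑ i ∈ Finset.range t, lam k ^ i
  have hg : ∀ u v, green (lazyP G) t u v = (∑ k, γ k * φ k u * φ k v) * auxS G v / auxS G u := by
    intro u v
    unfold green
    simp only [auxP_pow_eq G hG, h.pow_apply]
    rw [← Finset.sum_div, ← Finset.sum_mul, Finset.sum_comm]
    simp only [γ, Finset.sum_mul]
  have h1 : ∑ u, ∑ v, green (lazyP G) t u v * green (lazyP G) t v u = ∑ k, γ k ^ 2 := by
    calc _ = ∑ u, ∑ v, (∑ k, (γ k * φ k u) * φ k v) * (∑ k, (γ k * φ k u) * φ k v) := by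
          refine Finset.sum_congr rfl fun u _ => Finset.sum_congr rfl fun v _ => ?_
          rw [hg, hg]
          have hu := auxS_pos G hG u
          have hv := auxS_pos G hG v
          have : ∑ k, γ k * φ k v * φ k u = ∑ k, γ k * φ k u * φ k v :=
            Finset.sum_congr rfl fun k _ => by ring
          rw [this]
          field_simp
      _ = ∑ u, ∑ k, (γ k)^2 * (φ k u * φ k u) := by
          refine Finset.sum_congr rfl fun u _ => ?_
          rw [h.parseval]
          exact Finset.sum_congr rfl fun k _ => by ring
      _ = _ := by
          rw [Finset.sum_comm]
          refine Finset.sum_congr rfl fun k _ => ?_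
          rw [← Finset.mul_sum, h.on]; simp
  obtain ⟨hT, hrel⟩ := h.rel hG
  obtain ⟨k0, hk0, -⟩ := h.exists_top hG
  have hK := h.kemeny hG
  set T : ℝ := ((relTime (lazyP G) : ℕ) : ℝ)
  have hpt : ∀ k, γ k ^ 2 ≤ (if k = k0 then (t:ℝ)^2 else 0) + T * (if lam k = 1 then 0 else 1 / (1 - lam k)) := by
    intro k
    by_cases hk : lam k = 1
    · rw [if_pos ((hk0 k).1 hk), if_pos hk]
      simp [γ, hk]
    · rw [if_neg (fun hh => hk ((hk0 k).2 hh)), if_neg hk, zero_add]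
      have hle := h.lam_le hG k
      have h0 := h.lam_nonneg hG k
      have hlt : 0 < 1 - lam k := by
        have := lt_of_le_of_ne hle hk
        linarith
      have hγ : γ k ≤ 1 / (1 - lam k) := by
        rw [le_div_iff₀ hlt]
        have := geom_sum_mul_neg (lam k) t
        simp only [γ]
        rw [this]
        have : 0 ≤ lam k ^ t := pow_nonneg h0 t
        linarith
      have hγ0 : 0 ≤ γ k := Finset.sum_nonneg fun i _ => pow_nonneg h0 i
      calc γ k ^ 2 = γ k * γ k := sq _
        _ ≤ (1 / (1 - lam k)) * (1 / (1 - lam k)) := mul_le_mul hγ hγ hγ0 (by positivity)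
        _ ≤ T * (1 / (1 - lam k)) := mul_le_mul_of_nonneg_right (hrel k hk) (by positivity)
  rw [h1]
  have h2 := Finset.sum_le_sum fun k (_ : k ∈ Finset.univ) => hpt k
  rw [Finset.sum_add_distrib, ← Finset.mul_sum] at h2
  simp only [Finset.sum_ite_eq', Finset.mem_univ, if_true] at h2
  have h3 := mul_le_mul_of_nonneg_left hK (show 0 ≤ T by linarith)
  have h4 : T * (320 * (Fintype.card V : ℝ) * T ^ ((2:ℝ)/3)) = 320 * ((Fintype.card V : ℝ) * T ^ ((5:ℝ)/3)) := by
    have : T ^ ((5:ℝ)/3) = T * T ^ ((2:ℝ)/3) := by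
      rw [show (5:ℝ)/3 = 1 + 2/3 by norm_num, Real.rpow_add (by linarith), Real.rpow_one]
    rw [this]; ring
  have h5 : (0:ℝ) ≤ (t:ℝ)^2 := by positivity
  linarith

lemma aux_m_pos (hG : G.Connected) : (0:ℝ) < numEdges G := by
  obtain ⟨v⟩ : Nonempty V := inferInstance
  have h1 : 0 < ∑ u, (G.degree u : ℝ) :=
    Finset.sum_pos (fun u _ => by exact_mod_cast aux_deg_pos G hG u) ⟨v, Finset.mem_univ v⟩
  rw [aux_sum_deg] at h1
  linarith

lemma aux_pi_pos (hG : G.Connected) (u : V) : 0 < statDist G u := by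
  unfold statDist
  have h1 := aux_m_pos hG
  have h2 : (0:ℝ) < G.degree u := by exact_mod_cast aux_deg_pos G hG u
  positivity

lemma AuxSpec.mix (h : AuxSpec G lam φ) (hG : G.Connected) (x y : V) :
    (lazyP G ^ unifTime G) x y ≤ 5/4 * statDist G y := by
  have hne : {t : ℕ | ∀ x y : V, |(lazyP G ^ t) x y / statDist G y - 1| ≤ 1 / 4}.Nonempty := by
    have hlim : ∀ x y, Filter.Tendsto (fun t : ℕ => (lazyP G ^ t) x y / statDist G y - 1) Filter.atTop (nhds 0) := by
      intro x y
      obtain ⟨k0, hk0, c, hc, hcm⟩ := h.exists_top hG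
      have h1 : ∀ k, Filter.Tendsto (fun t : ℕ => lam k ^ t) Filter.atTop (nhds (if k = k0 then 1 else 0)) := by
        intro k
        by_cases hk : k = k0
        · simp [(hk0 k).2 hk, hk, (hk0 k0).2 rfl]
        · rw [if_neg hk]
          have hk' : lam k ≠ 1 := fun hh => hk ((hk0 k).1 hh)
          exact tendsto_pow_atTop_nhds_zero_of_lt_one (h.lam_nonneg hG k)
            (lt_of_le_of_ne (h.lam_le hG k) hk')
      have h2 : Filter.Tendsto (fun t : ℕ => ∑ k, lam k ^ t * φ k x * φ k y) Filter.atTop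
          (nhds (∑ k, (if k = k0 then 1 else 0) * φ k x * φ k y)) :=
        tendsto_finsetSum _ fun k _ => ((h1 k).mul_const _).mul_const _
      have h3 : ∑ k, (if k = k0 then (1:ℝ) else 0) * φ k x * φ k y = φ k0 x * φ k0 y := by
        simp
      rw [h3] at h2
      have hx := auxS_pos G hG x
      have hy := auxS_pos G hG y
      have h4 : (φ k0 x * φ k0 y) * auxS G y / auxS G x / statDist G y - 1 = 0 := by
        have hm := aux_m_pos hG
        rw [hc, hc]
        unfold statDist
        rw [← auxS_sq]
        field_simp
        linarith
      rw [← h4]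
      simp only [auxP_pow_eq G hG, h.pow_apply]
      exact (((h2.mul_const _).div_const _).div_const _).sub_const _
    have hev : ∀ᶠ t : ℕ in Filter.atTop, ∀ x y : V, |(lazyP G ^ t) x y / statDist G y - 1| ≤ 1 / 4 := by
      rw [Filter.eventually_all]
      intro x
      rw [Filter.eventually_all]
      intro y
      have := (hlim x y).abs
      rw [abs_zero] at this
      exact this.eventually_le_const (by norm_num)
    obtain ⟨t, ht⟩ := hev.exists
    exact ⟨t, ht⟩
  have hmem := Nat.sInf_mem hne
  have h1 := (abs_le.1 (hmem x y)).2
  have h2 : (lazyP G ^ unifTime G) x y / statDist G y ≤ 5/4 := by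
    have : unifTime G = sInf {t : ℕ | ∀ x y : V, |(lazyP G ^ t) x y / statDist G y - 1| ≤ 1 / 4} := rfl
    rw [this]; linarith
  rwa [div_le_iff₀ (aux_pi_pos hG y)] at h2

lemma auxP_nonneg (u v : V) : 0 ≤ lazyP G u v := by
  unfold lazyP
  split_ifs <;> positivity

lemma auxP_pow_nonneg (i : ℕ) : ∀ u v : V, 0 ≤ (lazyP G ^ i) u v := by
  induction i with
  | zero => intro u v; rw [pow_zero, Matrix.one_apply]; split_ifs <;> norm_num
  | succ i ih =>
    intro u v
    rw [pow_succ, Matrix.mul_apply]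
    exact Finset.sum_nonneg fun w _ => mul_nonneg (ih u w) (auxP_nonneg w v)

lemma auxP_row (hG : G.Connected) (x : V) : ∑ y, lazyP G x y = 1 := by
  simp only [auxP_eq G hG]
  rw [← Finset.sum_div, aux_s_eig hG, one_mul]
  exact div_self (auxS_pos G hG x).ne'

lemma auxP_pow_row (hG : G.Connected) (i : ℕ) : ∀ x : V, ∑ y, (lazyP G ^ i) x y = 1 := by
  induction i with
  | zero => intro x; simp [Matrix.one_apply]
  | succ i ih =>
    intro x
    rw [pow_succ]
    simp only [Matrix.mul_apply]
    rw [Finset.sum_comm]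
    simp only [← Finset.mul_sum, auxP_row hG, mul_one, ih]

lemma AuxSpec.mix' (h : AuxSpec G lam φ) (hG : G.Connected) (i : ℕ) (hi : unifTime G ≤ i) (x y : V) :
    (lazyP G ^ i) x y ≤ 5/4 * statDist G y := by
  obtain ⟨j, rfl⟩ := Nat.exists_eq_add_of_le' hi
  rw [pow_add, Matrix.mul_apply]
  calc _ ≤ ∑ z, (lazyP G ^ j) x z * (5/4 * statDist G y) :=
        Finset.sum_le_sum fun z _ => mul_le_mul_of_nonneg_left (h.mix hG z y) (auxP_pow_nonneg j x z)
    _ = _ := by rw [← Finset.sum_mul, auxP_pow_row hG, one_mul]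

lemma AuxSpec.pow_symm (h : AuxSpec G lam φ) (i : ℕ) (u v : V) : (auxA G ^ i) u v = (auxA G ^ i) v u := by
  rw [h.pow_apply, h.pow_apply]
  exact Finset.sum_congr rfl fun k _ => by ring

lemma AuxSpec.rev (h : AuxSpec G lam φ) (hG : G.Connected) (i : ℕ) (u v : V) :
    statDist G u * (lazyP G ^ i) u v = statDist G v * (lazyP G ^ i) v u := by
  rw [auxP_pow_eq G hG, auxP_pow_eq G hG, h.pow_symm i v u]
  unfold statDist
  have hu := auxS_pos G hG u
  have hv := auxS_pos G hG v
  rw [← auxS_sq, ← auxS_sq]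
  field_simp

lemma AuxSpec.two (h : AuxSpec G lam φ) (hG : G.Connected) (x u v : V) (t : ℕ) (i k : ℕ)
    (hi : i ∈ Finset.Ico (unifTime G) (unifTime G + t)) (hk : k ∈ Finset.Ico (unifTime G) (unifTime G + t)) :
    ∑ p : Fin (unifTime G + t) → V, pathWeight (lazyP G) x (unifTime G + t) p *
          ((if traj p i = u then 1 else 0) * (if traj p k = v then 1 else 0)) ≤
      5/4 * (statDist G u * (lazyP G ^ ((k - i) + (i - k))) u v) := by
  rw [Finset.mem_Ico] at hi hk
  obtain ⟨N, hN⟩ : ∃ N, unifTime G + t = N + 1 := ⟨unifTime G + t - 1, by omega⟩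
  rw [hN]
  rcases le_total i k with hik | hik
  · obtain ⟨l, rfl⟩ := Nat.exists_eq_add_of_le hik
    rw [aux_twopt _ (auxP_row hG) u v l i N x (by omega), show i + l - i + (i - (i + l)) = l by omega,
      ← mul_assoc]
    exact mul_le_mul_of_nonneg_right (h.mix' hG i hi.1 x u) (auxP_pow_nonneg l u v)
  · obtain ⟨l, rfl⟩ := Nat.exists_eq_add_of_le hik
    simp only [mul_comm (if traj _ (k+l) = u then (1:ℝ) else 0)]
    rw [aux_twopt _ (auxP_row hG) v u l k N x (by omega), show k - (k + l) + (k + l - k) = l by omega,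
      h.rev hG, ← mul_assoc]
    exact mul_le_mul_of_nonneg_right (h.mix' hG k hk.1 x v) (auxP_pow_nonneg l v u)

lemma aux_window (a t : ℕ) (F : ℕ → ℝ) (hF : ∀ i, 0 ≤ F i) (i : ℕ) (hi : i ∈ Finset.Ico a (a+t)) :
    ∑ k ∈ Finset.Ico a (a+t), F ((k - i) + (i - k)) ≤ 2 * ∑ j ∈ Finset.range t, F j := by
  rw [Finset.mem_Ico] at hi
  have h1 : ∑ k ∈ Finset.Ico a (a+t), F ((k - i) + (i - k)) ≤
      ∑ k ∈ Finset.Ico a (a+t), ((if i ≤ k then F (k - i) else 0) + (if k ≤ i then F (i - k) else 0)) := by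
    refine Finset.sum_le_sum fun k _ => ?_
    rcases lt_trichotomy i k with h | h | h
    · rw [if_pos h.le, if_neg (by omega), show i - k = 0 by omega]; simp
    · subst h; simp [hF 0]
    · rw [if_neg (by omega), if_pos h.le, show k - i = 0 by omega]; simp
  refine h1.trans ?_
  rw [Finset.sum_add_distrib, two_mul, ← Finset.sum_filter, ← Finset.sum_filter]
  apply add_le_add
  · rw [← Finset.sum_image (s := (Finset.Ico a (a+t)).filter (fun k => i ≤ k)) (g := fun k => k - i) (f := F)]
    · apply Finset.sum_le_sum_of_subset_of_nonneg
      · intro j hj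
        simp only [Finset.mem_image, Finset.mem_filter, Finset.mem_Ico] at hj
        obtain ⟨k, hk, rfl⟩ := hj
        rw [Finset.mem_range]; omega
      · intros; exact hF _
    · intro k hk l hl hkl
      simp only [Finset.coe_filter, Finset.mem_Ico, Set.mem_ofPred_eq] at hk hl hkl
      omega
  · rw [← Finset.sum_image (s := (Finset.Ico a (a+t)).filter (fun k => k ≤ i)) (g := fun k => i - k) (f := F)]
    · apply Finset.sum_le_sum_of_subset_of_nonneg
      · intro j hj
        simp only [Finset.mem_image, Finset.mem_filter, Finset.mem_Ico] at hj
        obtain ⟨k, hk, rfl⟩ := hj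
        rw [Finset.mem_range]; omega
      · intros; exact hF _
    · intro k hk l hl hkl
      simp only [Finset.coe_filter, Finset.mem_Ico, Set.mem_ofPred_eq] at hk hl hkl
      omega

lemma auxW_nonneg (x : V) (t : ℕ) (p : Fin t → V) : 0 ≤ pathWeight (lazyP G) x t p := by
  unfold pathWeight
  refine mul_nonneg (by split_ifs <;> norm_num) (Finset.prod_nonneg fun i _ => auxP_nonneg _ _)

lemma AuxSpec.final (h : AuxSpec G lam φ) (hG : G.Connected) (x : V) (t : ℕ) :
    EJsq G x t ≤ 500 * ((t : ℝ) ^ 2 / (numEdges G : ℝ) ^ 2) *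
          ((t : ℝ) ^ 2 +
            (Fintype.card V : ℝ) * (relTime (lazyP G) : ℝ) ^ ((5 : ℝ) / 3)) := by
  unfold EJsq
  rw [aux_expand]
  have hB : ∀ u v, (∑ i ∈ Finset.Ico (unifTime G) (unifTime G + t), ∑ k ∈ Finset.Ico (unifTime G) (unifTime G + t),
        ∑ p : Fin (unifTime G + t) → V, pathWeight (lazyP G) x (unifTime G + t) p *
          ((if traj p i = u then 1 else 0) * (if traj p k = v then 1 else 0)))
      ≤ 5/2 * t * (statDist G u * green (lazyP G) t u v) := by
    intro u v
    have hpi := aux_pi_pos hG u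
    calc _ ≤ ∑ i ∈ Finset.Ico (unifTime G) (unifTime G + t), 5/4 * (statDist G u * (2 * green (lazyP G) t u v)) := by
          refine Finset.sum_le_sum fun i hi => ?_
          refine (Finset.sum_le_sum fun k hk => h.two hG x u v t i k hi hk).trans ?_
          rw [← Finset.mul_sum, ← Finset.mul_sum]
          have := aux_window (unifTime G) t (fun j => (lazyP G ^ j) u v) (fun j => auxP_pow_nonneg j u v) i hi
          have h2 := mul_le_mul_of_nonneg_left this hpi.le
          exact mul_le_mul_of_nonneg_left h2 (by norm_num)
      _ = _ := by
          rw [Finset.sum_const, Nat.card_Ico, nsmul_eq_mul, Nat.add_sub_cancel_left]; ring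
  have hB0 : ∀ u v, 0 ≤ (∑ i ∈ Finset.Ico (unifTime G) (unifTime G + t), ∑ k ∈ Finset.Ico (unifTime G) (unifTime G + t),
        ∑ p : Fin (unifTime G + t) → V, pathWeight (lazyP G) x (unifTime G + t) p *
          ((if traj p i = u then (1:ℝ) else 0) * (if traj p k = v then 1 else 0))) := by
    intro u v
    refine Finset.sum_nonneg fun i _ => Finset.sum_nonneg fun k _ => Finset.sum_nonneg fun p _ => ?_
    refine mul_nonneg (auxW_nonneg _ _ _) (mul_nonneg ?_ ?_) <;> split_ifs <;> norm_num
  have hgrev : ∀ u v, statDist G u * green (lazyP G) t u v = statDist G v * green (lazyP G) t v u := by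
    intro u v
    unfold green
    rw [Finset.mul_sum, Finset.mul_sum]
    exact Finset.sum_congr rfl fun i _ => h.rev hG i u v
  have hm := aux_m_pos hG
  have hterm : ∀ u v, (1 / (G.degree u : ℝ)) * (1 / (G.degree v : ℝ)) *
      (∑ i ∈ Finset.Ico (unifTime G) (unifTime G + t), ∑ k ∈ Finset.Ico (unifTime G) (unifTime G + t),
        ∑ p : Fin (unifTime G + t) → V, pathWeight (lazyP G) x (unifTime G + t) p *
          ((if traj p i = u then 1 else 0) * (if traj p k = v then 1 else 0)))^2 ≤
      25/16 * ((t:ℝ)^2 / (numEdges G : ℝ)^2) * (green (lazyP G) t u v * green (lazyP G) t v u) := by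
    intro u v
    have hu : (0:ℝ) < G.degree u := by exact_mod_cast aux_deg_pos G hG u
    have hv : (0:ℝ) < G.degree v := by exact_mod_cast aux_deg_pos G hG v
    calc _ ≤ (1 / (G.degree u : ℝ)) * (1 / (G.degree v : ℝ)) * (5/2 * t * (statDist G u * green (lazyP G) t u v))^2 := by
          refine mul_le_mul_of_nonneg_left ?_ (by positivity)
          exact pow_le_pow_left₀ (hB0 u v) (hB u v) 2
      _ = (1 / (G.degree u : ℝ)) * (1 / (G.degree v : ℝ)) * (25/4 * (t:ℝ)^2 *
            ((statDist G u * green (lazyP G) t u v) * (statDist G v * green (lazyP G) t v u))) := by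
          rw [← hgrev u v]; ring
      _ = _ := by
          unfold statDist
          field_simp
          ring
  refine (Finset.sum_le_sum fun u _ => Finset.sum_le_sum fun v _ => hterm u v).trans ?_
  simp only [← Finset.mul_sum]
  have h1 := h.trace_bound hG t
  have h2 := mul_le_mul_of_nonneg_left h1 (show 0 ≤ 25/16 * ((t:ℝ)^2 / (numEdges G : ℝ)^2) by positivity)
  refine h2.trans (le_of_eq ?_)
  ring

end Final

/-- There is a universal constant `C > 0` such that for every finite
connected graph `G` with `n` vertices, `m` edges and relaxation time `t_rel`, every vertex
`x` and every `t ≥ 1`: `E_x[𝓙_t²] ≤ C (t²/m²)(t² + n t_rel^{5/3})`. -/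
theorem second_moment_J_bound : ∃ C : ℝ, 0 < C ∧
    ∀ (V : Type) [Fintype V] [Nontrivial V] (G : SimpleGraph V), G.Connected →
      ∀ (x : V) (t : ℕ), 1 ≤ t →
        EJsq G x t ≤ C * ((t : ℝ) ^ 2 / (numEdges G : ℝ) ^ 2) *
          ((t : ℝ) ^ 2 +
            (Fintype.card V : ℝ) * (relTime (lazyP G) : ℝ) ^ ((5 : ℝ) / 3)) := by
  refine ⟨500, by norm_num, ?_⟩
  intro V _ _ G hG x t _
  obtain ⟨lam, φ, h⟩ := aux_exists_spec G
  exact h.final hG x t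
end
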